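/- arXiv:1901.01885 — 6 statements merged into one kernel-verified Lean document; each statement's English description precedes it below -/
import Mathlib

section
/- Let F : ℝ² → ℝ² be a continuously differentiable vector field admitting a global flow Φ : ℝ × ℝ² → ℝ² (i.e. Φ(0,x) = x, Φ(t+s,x) = Φ(t,Φ(s,x)), and for every x and t the map t ↦ Φ(t,x) has derivative F(Φ(t,x))). Let K ⊂ ℝ² be compact and δ > 0 be such that the divergence of F (the trace of the Fréchet derivative of F) satisfies div F(x) ≥ δ for all x ∈ K. If A ⊆ K is Lebesgue measurable, T > 0, and Φ(s,·) maps A into K for every s ∈ [0,T], then the Lebesgue measure of the image Φ(T,·)''A is at least e^{δT} times the Lebesgue measure of A. -/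
open MeasureTheory Set Filter Topology

/-- Short-time confinement and Lipschitz dependence of the flow on a ball. -/
lemma flow_local (F : ℝ × ℝ → ℝ × ℝ) (hF : ContDiff ℝ 1 F)
    (Φ : ℝ → ℝ × ℝ → ℝ × ℝ)
    (hΦ0 : ∀ x, Φ 0 x = x)
    (hΦderiv : ∀ x t, HasDerivAt (fun τ => Φ τ x) (F (Φ t x)) t) (R : ℝ) :
    ∃ M L C h0 : ℝ, 0 < M ∧ 0 < L ∧ 0 < C ∧ 0 < h0 ∧
      (∀ x ∈ Metric.closedBall (0 : ℝ × ℝ) (R + 1), ‖fderiv ℝ F x‖ ≤ L) ∧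
      (∀ x ∈ Metric.closedBall (0 : ℝ × ℝ) (R + 1), ∀ y ∈ Metric.closedBall (0 : ℝ × ℝ) (R + 1),
        ‖F y - F x‖ ≤ L * ‖y - x‖) ∧
      (∀ x ∈ Metric.closedBall (0 : ℝ × ℝ) R, ∀ s ∈ Icc 0 h0,
        Φ s x ∈ Metric.closedBall (0 : ℝ × ℝ) (R + 1)) ∧
      (∀ x ∈ Metric.closedBall (0 : ℝ × ℝ) R, ∀ s ∈ Icc 0 h0, ‖Φ s x - x‖ ≤ M * s) ∧
      (∀ x ∈ Metric.closedBall (0 : ℝ × ℝ) R, ∀ y ∈ Metric.closedBall (0 : ℝ × ℝ) R,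
        ∀ s ∈ Icc 0 h0, ‖Φ s y - Φ s x‖ ≤ C * ‖y - x‖) := by
  have hcomp : IsCompact (Metric.closedBall (0 : ℝ × ℝ) (R + 1)) := isCompact_closedBall _ _
  have hDc : Continuous (fderiv ℝ F) := hF.continuous_fderiv (by norm_num)
  obtain ⟨M0, hM0⟩ := hcomp.exists_bound_of_continuousOn hF.continuous.continuousOn
  obtain ⟨L0, hL0⟩ := hcomp.exists_bound_of_continuousOn hDc.continuousOn
  set M : ℝ := |M0| + 1 with hM
  set L : ℝ := |L0| + 1 with hL
  have hMpos : 0 < M := by positivity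
  have hLpos : 0 < L := by positivity
  have hFM : ∀ x ∈ Metric.closedBall (0 : ℝ × ℝ) (R + 1), ‖F x‖ < M := fun x hx =>
    lt_of_le_of_lt ((hM0 x hx).trans (le_abs_self _)) (by simp [hM])
  have hFL : ∀ x ∈ Metric.closedBall (0 : ℝ × ℝ) (R + 1), ‖fderiv ℝ F x‖ ≤ L := fun x hx =>
    ((hL0 x hx).trans (le_abs_self _)).trans (by simp [hL])
  have hdiff : Differentiable ℝ F := hF.differentiable (by norm_num)
  have hlip : ∀ x ∈ Metric.closedBall (0 : ℝ × ℝ) (R + 1),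
      ∀ y ∈ Metric.closedBall (0 : ℝ × ℝ) (R + 1), ‖F y - F x‖ ≤ L * ‖y - x‖ := fun x hx y hy =>
    (convex_closedBall (0 : ℝ × ℝ) (R + 1)).norm_image_sub_le_of_norm_fderiv_le
      (fun z _ => hdiff z) hFL hx hy
  have hcont : ∀ x, Continuous (fun τ => Φ τ x) := fun x =>
    continuous_iff_continuousAt.2 fun t => (hΦderiv x t).continuousAt
  have hconf : ∀ x ∈ Metric.closedBall (0 : ℝ × ℝ) R, ∀ s ∈ Icc 0 (1 / M),
        Φ s x ∈ Metric.closedBall (0 : ℝ × ℝ) (R + 1) := by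
    intro x hx s hs
    have hMs : ∀ s ∈ Icc 0 (1 / M), R + M * s ≤ R + 1 := by
      intro s hs
      have := mul_le_mul_of_nonneg_left hs.2 hMpos.le
      rw [mul_one_div_cancel hMpos.ne'] at this
      linarith
    have h1 := image_norm_le_of_norm_deriv_right_lt_deriv_boundary (a := 0) (b := 1 / M)
      (f := fun τ => Φ τ x) (f' := fun τ => F (Φ τ x)) (B := fun s => R + M * s)
      (B' := fun _ => M) (hcont x).continuousOn
      (fun t _ => (hΦderiv x t).hasDerivWithinAt)
      (by simpa [hΦ0] using hx)
      (fun t => by simpa using ((hasDerivAt_id t).const_mul M).const_add R)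
      (fun t ht hn => hFM _ (by
        rw [mem_closedBall_zero_iff]
        exact hn.le.trans (hMs t (Ico_subset_Icc_self ht)))) hs
    rw [mem_closedBall_zero_iff]
    exact h1.trans (hMs s hs)
  refine ⟨M, L, Real.exp (L * (1 / M)), 1 / M, hMpos, hLpos, Real.exp_pos _, by positivity,
    hFL, hlip, hconf, ?_, ?_⟩
  · intro x hx s hs
    have := norm_image_sub_le_of_norm_deriv_le_segment' (a := 0) (b := 1 / M)
      (f := fun τ => Φ τ x) (f' := fun τ => F (Φ τ x)) (C := M)
      (fun t _ => (hΦderiv x t).hasDerivWithinAt)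
      (fun t ht => (hFM _ (hconf x hx t (Ico_subset_Icc_self ht))).le) s hs
    simpa [hΦ0] using this
  · intro x hx y hy s hs
    have hLip : LipschitzOnWith ⟨L, hLpos.le⟩ F (Metric.closedBall (0 : ℝ × ℝ) (R + 1)) :=
      LipschitzOnWith.of_dist_le_mul fun a ha b hb => by
        rw [dist_eq_norm, dist_eq_norm]; exact hlip b hb a ha
    have := dist_le_of_trajectories_ODE_of_mem (a := 0) (b := 1 / M) (v := fun _ => F)
      (s := fun _ => Metric.closedBall (0 : ℝ × ℝ) (R + 1))
      (f := fun τ => Φ τ y) (g := fun τ => Φ τ x) (δ := ‖y - x‖)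
      (fun _ _ => hLip) (hcont y).continuousOn
      (fun t _ => (hΦderiv y t).hasDerivWithinAt)
      (fun t ht => hconf y hy t (Ico_subset_Icc_self ht))
      (hcont x).continuousOn
      (fun t _ => (hΦderiv x t).hasDerivWithinAt)
      (fun t ht => hconf x hx t (Ico_subset_Icc_self ht))
      (by simp [hΦ0, dist_eq_norm]) s hs
    rw [dist_eq_norm, mul_comm] at this
    refine this.trans (mul_le_mul_of_nonneg_right (Real.exp_le_exp.2 ?_) (norm_nonneg _))
    simp only [sub_zero]
    exact mul_le_mul_of_nonneg_left hs.2 hLpos.le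

/-- The remainder in the Euler approximation of the flow has a small local Lipschitz constant. -/
lemma flow_euler (F : ℝ × ℝ → ℝ × ℝ) (hF : ContDiff ℝ 1 F)
    (Φ : ℝ → ℝ × ℝ → ℝ × ℝ)
    (hΦ0 : ∀ x, Φ 0 x = x)
    (hΦderiv : ∀ x t, HasDerivAt (fun τ => Φ τ x) (F (Φ t x)) t) (R : ℝ) :
    ∃ L C : ℝ, 0 < L ∧ 0 < C ∧ (∀ x ∈ Metric.ball (0 : ℝ × ℝ) R, ‖fderiv ℝ F x‖ ≤ L) ∧
    ∀ η > 0, ∃ h1 > 0, ∀ h ∈ Icc 0 h1,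
      (∀ x ∈ Metric.ball (0 : ℝ × ℝ) R, ∀ y ∈ Metric.ball (0 : ℝ × ℝ) R,
        ‖Φ h y - Φ h x‖ ≤ C * ‖y - x‖) ∧
      ∀ x ∈ Metric.ball (0 : ℝ × ℝ) R, ∀ᶠ y in 𝓝 x,
        ‖(Φ h y - y - h • F y) - (Φ h x - x - h • F x)‖ ≤ η * h * ‖y - x‖ := by
  obtain ⟨M, L, C, h0, hM, hL, hC, hh0, hFL, hlip, hconf, hmove, hΦlip⟩ :=
    flow_local F hF Φ hΦ0 hΦderiv R
  have hsub : Metric.ball (0 : ℝ × ℝ) R ⊆ Metric.closedBall 0 R := Metric.ball_subset_closedBall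
  have hsub' : Metric.closedBall (0 : ℝ × ℝ) R ⊆ Metric.closedBall 0 (R + 1) :=
    Metric.closedBall_subset_closedBall (by linarith)
  have hdiff : Differentiable ℝ F := hF.differentiable (by norm_num)
  have hDc : Continuous (fderiv ℝ F) := hF.continuous_fderiv (by norm_num)
  have hUC := (isCompact_closedBall (0 : ℝ × ℝ) (R + 1)).uniformContinuousOn_of_continuous
    hDc.continuousOn
  refine ⟨L, C, hL, hC, fun x hx => hFL x (hsub' (hsub hx)), fun η hη => ?_⟩
  rw [Metric.uniformContinuousOn_iff] at hUC
  set ε := η / (2 * (C + 1)) with hε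
  have hεpos : 0 < ε := by positivity
  have hεC : ε * (C + 1) = η / 2 := by rw [hε]; field_simp
  obtain ⟨ρ, hρ, hUC⟩ := hUC ε hεpos
  refine ⟨min h0 (min (η / (2 * (L * L * C))) (ρ / (2 * M) / 2)), by positivity, fun h hh => ?_⟩
  have hhh0 : h ≤ h0 := hh.2.trans (min_le_left _ _)
  have hhη : L * L * C * h ≤ η / 2 := by
    have : h ≤ η / (2 * (L * L * C)) := hh.2.trans ((min_le_right _ _).trans (min_le_left _ _))
    rw [le_div_iff₀ (by positivity)] at this
    linarith
  have hhρ : M * h < ρ / 2 := by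
    have : h ≤ ρ / (2 * M) / 2 := hh.2.trans ((min_le_right _ _).trans (min_le_right _ _))
    rw [div_div, le_div_iff₀ (by positivity)] at this
    nlinarith
  have hI : ∀ s ∈ Icc 0 h, s ∈ Icc 0 h0 := fun s hs => ⟨hs.1, hs.2.trans hhh0⟩
  refine ⟨fun x hx y hy => hΦlip x (hsub hx) y (hsub hy) h ⟨hh.1, hhh0⟩, fun x hx => ?_⟩
  filter_upwards [Metric.isOpen_ball.mem_nhds hx, Metric.ball_mem_nhds x (half_pos hρ)] with y hy hyx
  have hx' := hsub hx
  have hy' := hsub hy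
  have hyx' : ‖y - x‖ < ρ / 2 := by rwa [Metric.mem_ball, dist_eq_norm] at hyx
  set S := Metric.ball x ρ ∩ Metric.closedBall (0 : ℝ × ℝ) (R + 1) with hS
  have hconv : Convex ℝ S := (convex_ball x ρ).inter (convex_closedBall _ _)
  have hFS : ∀ a ∈ S, ∀ b ∈ S, ‖F b - F a - fderiv ℝ F x (b - a)‖ ≤ ε * ‖b - a‖ := by
    intro a ha b hb
    refine hconv.norm_image_sub_le_of_norm_fderiv_le' (fun z _ => hdiff z) (fun z hz => ?_) ha hb
    rw [← dist_eq_norm]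
    exact (hUC z hz.2 x (hsub' hx') hz.1).le
  have hmem : ∀ s ∈ Icc 0 h, ∀ z ∈ Metric.closedBall (0 : ℝ × ℝ) R, ‖z - x‖ < ρ / 2 →
      Φ s z ∈ S := by
    intro s hs z hz hzx
    refine ⟨?_, hconf z hz s (hI s hs)⟩
    rw [Metric.mem_ball, dist_eq_norm]
    have h1 := hmove z hz s (hI s hs)
    have h2 : M * s ≤ M * h := mul_le_mul_of_nonneg_left hs.2 hM.le
    calc ‖Φ s z - x‖ = ‖(Φ s z - z) + (z - x)‖ := by congr 1; abel
      _ ≤ ‖Φ s z - z‖ + ‖z - x‖ := norm_add_le _ _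
      _ < ρ := by linarith
  have hzero : (0 : ℝ) ∈ Icc 0 h := ⟨le_rfl, hh.1⟩
  have hxS : x ∈ S := by
    have := hmem 0 hzero x hx' (by simpa using half_pos hρ); rwa [hΦ0] at this
  have hyS : y ∈ S := by
    have := hmem 0 hzero y hy' hyx'; rwa [hΦ0] at this
  have hw : ∀ s ∈ Icc 0 h, ‖(Φ s y - Φ s x) - (y - x)‖ ≤ L * (C * ‖y - x‖) * h := by
    intro s hs
    have := norm_image_sub_le_of_norm_deriv_le_segment' (a := 0) (b := h)
      (f := fun τ => Φ τ y - Φ τ x) (f' := fun τ => F (Φ τ y) - F (Φ τ x)) (C := L * (C * ‖y - x‖))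
      (fun t _ => ((hΦderiv y t).sub (hΦderiv x t)).hasDerivWithinAt)
      (fun t ht => by
        have ht' := hI t (Ico_subset_Icc_self ht)
        exact (hlip _ (hconf x hx' t ht') _ (hconf y hy' t ht')).trans
          (mul_le_mul_of_nonneg_left (hΦlip x hx' y hy' t ht') hL.le)) s hs
    simp only [hΦ0, sub_zero] at this
    exact this.trans (mul_le_mul_of_nonneg_left hs.2 (by positivity))
  have hu := norm_image_sub_le_of_norm_deriv_le_segment' (a := 0) (b := h)
      (f := fun τ => (Φ τ y - y - τ • F y) - (Φ τ x - x - τ • F x))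
      (f' := fun τ => (F (Φ τ y) - (1 : ℝ) • F y) - (F (Φ τ x) - (1 : ℝ) • F x))
      (C := η * ‖y - x‖)
      (fun t _ => ((((hΦderiv y t).sub_const y).sub ((hasDerivAt_id t).smul_const (F y))).sub
        (((hΦderiv x t).sub_const x).sub ((hasDerivAt_id t).smul_const (F x)))).hasDerivWithinAt)
      (fun t ht => by
        have ht := Ico_subset_Icc_self ht
        have e1 := hFS _ (hmem t ht x hx' (by simpa using half_pos hρ)) _ (hmem t ht y hy' hyx')
        have e2 := hFS x hxS y hyS
        have e3 := hw t ht
        have e4 := hΦlip x hx' y hy' t (hI t ht)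
        have e5 : ‖fderiv ℝ F x ((Φ t y - Φ t x) - (y - x))‖ ≤ L * (L * (C * ‖y - x‖) * h) :=
          ((fderiv ℝ F x).le_of_opNorm_le (hFL x (hsub' hx')) _).trans
            (mul_le_mul_of_nonneg_left e3 hL.le)
        have e6 : (F (Φ t y) - (1 : ℝ) • F y) - (F (Φ t x) - (1 : ℝ) • F x) =
            (F (Φ t y) - F (Φ t x) - fderiv ℝ F x (Φ t y - Φ t x)) -
            (F y - F x - fderiv ℝ F x (y - x)) + fderiv ℝ F x ((Φ t y - Φ t x) - (y - x)) := by
          rw [map_sub _ (Φ t y - Φ t x) (y - x), one_smul, one_smul]; abel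
        rw [e6]
        have e7 : ε * ‖Φ t y - Φ t x‖ ≤ ε * (C * ‖y - x‖) := mul_le_mul_of_nonneg_left e4 hεpos.le
        have e8 : L * L * C * h * ‖y - x‖ ≤ η / 2 * ‖y - x‖ :=
          mul_le_mul_of_nonneg_right hhη (norm_nonneg _)
        have e9 : ε * (C + 1) * ‖y - x‖ = η / 2 * ‖y - x‖ := by rw [hεC]
        refine (norm_add_le _ _).trans ((add_le_add (norm_sub_le _ _) e5).trans ?_)
        linarith) h ⟨hh.1, le_rfl⟩
  simp only [hΦ0, zero_smul, sub_self, sub_zero] at hu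
  linarith

lemma det_prod_formula (D : (ℝ × ℝ) →L[ℝ] ℝ × ℝ) :
    D.det = (D (1, 0)).1 * (D (0, 1)).2 - (D (0, 1)).1 * (D (1, 0)).2 := by
  rw [ContinuousLinearMap.det, ← LinearMap.det_toMatrix (Module.Basis.finTwoProd ℝ),
    Matrix.det_fin_two]
  simp [LinearMap.toMatrix_apply]

lemma trace_prod_formula (D : (ℝ × ℝ) →L[ℝ] ℝ × ℝ) :
    LinearMap.trace ℝ (ℝ × ℝ) (D : (ℝ × ℝ) →ₗ[ℝ] ℝ × ℝ) = (D (1, 0)).1 + (D (0, 1)).2 := by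
  rw [LinearMap.trace_eq_matrix_trace ℝ (Module.Basis.finTwoProd ℝ), Matrix.trace_fin_two]
  simp [LinearMap.toMatrix_apply]

lemma entry_bounds (N : (ℝ × ℝ) →L[ℝ] ℝ × ℝ) (c : ℝ) (hN : ‖N‖ ≤ c) :
    |(N (1, 0)).1| ≤ c ∧ |(N (1, 0)).2| ≤ c ∧ |(N (0, 1)).1| ≤ c ∧ |(N (0, 1)).2| ≤ c := by
  have h1 : ‖N (1, 0)‖ ≤ c := by
    have := N.le_of_opNorm_le hN (1, 0); simpa [Prod.norm_def] using this
  have h2 : ‖N (0, 1)‖ ≤ c := by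
    have := N.le_of_opNorm_le hN (0, 1); simpa [Prod.norm_def] using this
  exact ⟨(norm_fst_le _).trans h1, (norm_snd_le _).trans h1, (norm_fst_le _).trans h2,
    (norm_snd_le _).trans h2⟩

lemma det_lower (D P : (ℝ × ℝ) →L[ℝ] ℝ × ℝ) (L η h : ℝ) (hL : 0 < L) (hP : ‖P‖ ≤ L)
    (hh : 0 < h) (hη1 : η ≤ 1)
    (hD : ‖D - (ContinuousLinearMap.id ℝ (ℝ × ℝ) + h • P)‖ ≤ η * h) :
    1 + h * (LinearMap.trace ℝ (ℝ × ℝ) (P : (ℝ × ℝ) →ₗ[ℝ] ℝ × ℝ) - 2 * η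
      - 2 * (L + 1) ^ 2 * h) ≤ D.det := by
  obtain ⟨p1, p2, p3, p4⟩ := entry_bounds P L hP
  obtain ⟨g1, g2, g3, g4⟩ := entry_bounds _ _ hD
  have hq : ‖D - ContinuousLinearMap.id ℝ (ℝ × ℝ)‖ ≤ h * (L + 1) := by
    have e : D - ContinuousLinearMap.id ℝ (ℝ × ℝ) =
      (D - (ContinuousLinearMap.id ℝ (ℝ × ℝ) + h • P)) + h • P := by abel
    rw [e]
    refine (norm_add_le _ _).trans ?_
    rw [norm_smul, Real.norm_of_nonneg hh.le]
    nlinarith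
  obtain ⟨q1, q2, q3, q4⟩ := entry_bounds _ _ hq
  rw [det_prod_formula, trace_prod_formula]
  simp only [ContinuousLinearMap.sub_apply, ContinuousLinearMap.add_apply,
    ContinuousLinearMap.smul_apply, ContinuousLinearMap.id_apply, Prod.fst_sub, Prod.snd_sub,
    Prod.fst_add, Prod.snd_add, Prod.smul_fst, Prod.smul_snd, smul_eq_mul] at g1 g4 q1 q2 q3 q4
  generalize (D (1, 0)).1 = a at *
  generalize (D (1, 0)).2 = b at *
  generalize (D (0, 1)).1 = c at *
  generalize (D (0, 1)).2 = d at *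
  have m1 : |(a - 1) * (d - 1)| ≤ (h * (L + 1)) * (h * (L + 1)) := by
    rw [abs_mul]; exact mul_le_mul q1 q4 (abs_nonneg _) (by positivity)
  have m2 : |(c - 0) * (b - 0)| ≤ (h * (L + 1)) * (h * (L + 1)) := by
    rw [abs_mul]; exact mul_le_mul q3 q2 (abs_nonneg _) (by positivity)
  rw [abs_le] at m1 m2 g1 g4
  nlinarith [m1.1, m2.2, g1.1, g4.1]

/-- One short step of the flow expands volume. -/
lemma flow_step (F : ℝ × ℝ → ℝ × ℝ) (hF : ContDiff ℝ 1 F)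
    (Φ : ℝ → ℝ × ℝ → ℝ × ℝ)
    (hΦ0 : ∀ x, Φ 0 x = x)
    (hΦadd : ∀ t s x, Φ (t + s) x = Φ t (Φ s x))
    (hΦderiv : ∀ x t, HasDerivAt (fun τ => Φ τ x) (F (Φ t x)) t)
    (K : Set (ℝ × ℝ)) (hK : IsCompact K) (δ : ℝ)
    (hdiv : ∀ x ∈ K, δ ≤ LinearMap.trace ℝ (ℝ × ℝ) (fderiv ℝ F x : (ℝ × ℝ) →ₗ[ℝ] ℝ × ℝ))
    (c : ℝ) (hc : c < δ) :
    ∃ h1 > 0, ∀ h ∈ Ioc 0 h1, ∀ B ⊆ K, MeasurableSet B → MeasurableSet (Φ h '' B) ∧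
      ENNReal.ofReal (1 + c * h) * volume B ≤ volume (Φ h '' B) := by
  obtain ⟨R, hR⟩ := hK.isBounded.subset_ball (0 : ℝ × ℝ)
  obtain ⟨L, C, hL, hC, hFL, H⟩ := flow_euler F hF Φ hΦ0 hΦderiv R
  set η := min 1 ((δ - c) / 4) with hη
  have hδc : 0 < δ - c := sub_pos.2 hc
  have hηpos : 0 < η := by positivity
  have hη4 : η ≤ (δ - c) / 4 := min_le_right _ _
  obtain ⟨h1, hh1, H⟩ := H η hηpos
  refine ⟨min h1 ((δ - c) / (4 * (L + 1) ^ 2)), by positivity, fun h hh B hBK hB => ?_⟩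
  have hh2 : (L + 1) ^ 2 * h ≤ (δ - c) / 4 := by
    have : h ≤ (δ - c) / (4 * (L + 1) ^ 2) := hh.2.trans (min_le_right _ _)
    rw [le_div_iff₀ (by positivity)] at this
    linarith
  obtain ⟨hlip, heul⟩ := H h ⟨hh.1.le, hh.2.trans (min_le_left _ _)⟩
  have hLip : LipschitzOnWith ⟨C, hC.le⟩ (Φ h) (Metric.ball (0 : ℝ × ℝ) R) :=
    LipschitzOnWith.of_dist_le_mul fun a ha b hb => by
      rw [dist_eq_norm, dist_eq_norm]; exact hlip b hb a ha
  have hinj : Function.Injective (Φ h) := by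
    intro a b hab
    have := congrArg (Φ (-h)) hab
    rwa [← hΦadd, ← hΦadd, neg_add_cancel, hΦ0, hΦ0] at this
  have hBR := hBK.trans hR
  refine ⟨hB.image_of_continuousOn_injOn (hLip.continuousOn.mono hBR) hinj.injOn, ?_⟩
  have hae : ∀ᵐ x ∂(volume : Measure (ℝ × ℝ)), x ∈ Metric.ball (0 : ℝ × ℝ) R →
      DifferentiableWithinAt ℝ (Φ h) (Metric.ball (0 : ℝ × ℝ) R) x :=
    hLip.ae_differentiableWithinAt_of_mem
  obtain ⟨t, ht, htm, ht0⟩ := exists_measurable_superset_of_null (ae_iff.1 hae)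
  have hgood : ∀ x ∈ B \ t, DifferentiableAt ℝ (Φ h) x := by
    intro x hx
    have h3 : x ∈ Metric.ball (0 : ℝ × ℝ) R → DifferentiableWithinAt ℝ (Φ h)
        (Metric.ball (0 : ℝ × ℝ) R) x := by
      by_contra hcon
      exact hx.2 (ht hcon)
    exact (h3 (hBR hx.1)).differentiableAt (Metric.isOpen_ball.mem_nhds (hBR hx.1))
  have hdet : ∀ x ∈ B \ t, 1 + c * h ≤ |(fderiv ℝ (Φ h) x).det| := by
    intro x hx
    have hd := (hgood x hx).hasFDerivAt
    have hFd : HasFDerivAt F (fderiv ℝ F x) x :=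
      (hF.differentiable (by norm_num) x).hasFDerivAt
    have hbd := ((hd.sub (hasFDerivAt_id x)).sub (hFd.const_smul h)).le_of_lip'
      (C := η * h) (by have := hh.1; positivity) (heul x (hBR hx.1))
    rw [sub_sub] at hbd
    have h4 := det_lower _ _ L η h hL (hFL x (hBR hx.1)) hh.1 (min_le_left _ _) hbd
    refine le_trans ?_ (h4.trans (le_abs_self _))
    have h5 := hdiv x (hBK hx.1)
    have h6 := hh.1
    rw [mul_comm c h]
    gcongr
    linarith
  have hBt : volume (B \ t) = volume B := measure_sdiff_null ht0
  calc ENNReal.ofReal (1 + c * h) * volume B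
      = ∫⁻ _ in B \ t, ENNReal.ofReal (1 + c * h) := by rw [setLIntegral_const, hBt]
    _ ≤ ∫⁻ x in B \ t, ENNReal.ofReal |(fderiv ℝ (Φ h) x).det| :=
        setLIntegral_mono' (hB.diff htm) fun x hx => ENNReal.ofReal_le_ofReal (hdet x hx)
    _ = volume (Φ h '' (B \ t)) :=
        lintegral_abs_det_fderiv_eq_addHaar_image volume (hB.diff htm)
          (fun x hx => (hgood x hx).hasFDerivAt.hasFDerivWithinAt) hinj.injOn
    _ ≤ volume (Φ h '' B) := measure_mono (image_mono diff_subset)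

/-- For a C¹ planar vector field `F` with global flow `Φ`, if the divergence
of `F` (trace of the Fréchet derivative) is at least `δ > 0` on a compact set `K`, then for any
measurable `A ⊆ K` whose images under the flow stay in `K` up to time `T > 0`, the Lebesgue
measure of `Φ T '' A` is at least `exp (δ * T)` times the measure of `A`. -/
theorem stmt_0
    (F : ℝ × ℝ → ℝ × ℝ) (hF : ContDiff ℝ 1 F)
    (Φ : ℝ → ℝ × ℝ → ℝ × ℝ)
    (hΦ0 : ∀ x, Φ 0 x = x)
    (hΦadd : ∀ t s x, Φ (t + s) x = Φ t (Φ s x))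
    (hΦderiv : ∀ x t, HasDerivAt (fun τ => Φ τ x) (F (Φ t x)) t)
    (K : Set (ℝ × ℝ)) (hK : IsCompact K)
    (δ : ℝ) (hδ : 0 < δ)
    (hdiv : ∀ x ∈ K, δ ≤ LinearMap.trace ℝ (ℝ × ℝ) (fderiv ℝ F x : (ℝ × ℝ) →ₗ[ℝ] ℝ × ℝ))
    (A : Set (ℝ × ℝ)) (hA : MeasurableSet A) (hAK : A ⊆ K)
    (T : ℝ) (hT : 0 < T)
    (hstay : ∀ s ∈ Set.Icc (0 : ℝ) T, Φ s '' A ⊆ K) :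
    ENNReal.ofReal (Real.exp (δ * T)) * volume A ≤ volume (Φ T '' A) := by
  have hexp : ∀ c : ℝ, 0 < c → c < δ →
      ENNReal.ofReal (Real.exp (c * T)) * volume A ≤ volume (Φ T '' A) := by
    intro c hc0 hc
    obtain ⟨h1, hh1, hstep⟩ := flow_step F hF Φ hΦ0 hΦadd hΦderiv K hK δ hdiv c hc
    have hlim : Tendsto (fun n : ℕ => ENNReal.ofReal ((1 + c * T / n) ^ n) * volume A) atTop
        (𝓝 (ENNReal.ofReal (Real.exp (c * T)) * volume A)) :=
      ENNReal.Tendsto.mul_const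
        (ENNReal.tendsto_ofReal (Real.tendsto_one_add_div_pow_exp (c * T)))
        (Or.inl (by simpa using Real.exp_pos (c * T)))
    refine le_of_tendsto hlim ?_
    have hev : ∀ᶠ n : ℕ in atTop, T / n < h1 :=
      (tendsto_const_div_atTop_nhds_zero_nat T).eventually (gt_mem_nhds hh1)
    filter_upwards [hev, eventually_gt_atTop 0] with n hn hn0
    have hnpos : (0 : ℝ) < n := by exact_mod_cast hn0
    set h := T / n with hh
    have hhpos : 0 < h := by positivity
    have hnh : n * h = T := by rw [hh]; field_simp
    have key : ∀ k : ℕ, k ≤ n → MeasurableSet (Φ (k * h) '' A) ∧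
        ENNReal.ofReal ((1 + c * h) ^ k) * volume A ≤ volume (Φ (k * h) '' A) := by
      intro k
      induction k with
      | zero => intro _; simp [hΦ0, hA]
      | succ k ih =>
        intro hk
        obtain ⟨i1, i2⟩ := ih (by omega)
        have hkT : (k : ℝ) * h ≤ T := by
          rw [← hnh]
          have : (k : ℝ) ≤ n := by exact_mod_cast (by omega : k ≤ n)
          gcongr
        have hs := hstep h ⟨hhpos, hn.le⟩ _ (hstay (k * h) ⟨by positivity, hkT⟩) i1
        have e : Φ ((k + 1 : ℕ) * h) '' A = Φ h '' (Φ (k * h) '' A) := by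
          rw [image_image]
          refine image_congr fun x _ => ?_
          rw [← hΦadd]
          congr 1
          push_cast
          ring
        rw [e]
        refine ⟨hs.1, le_trans ?_ hs.2⟩
        rw [pow_succ', ENNReal.ofReal_mul (by positivity), mul_assoc]
        gcongr
    have := (key n le_rfl).2
    rw [hnh] at this
    rwa [mul_div_assoc]
  have hlim : Tendsto (fun c : ℝ => ENNReal.ofReal (Real.exp (c * T)) * volume A) (𝓝[<] δ)
      (𝓝 (ENNReal.ofReal (Real.exp (δ * T)) * volume A)) := by
    refine ENNReal.Tendsto.mul_const (ENNReal.tendsto_ofReal ?_)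
        (Or.inl (by simpa using Real.exp_pos (δ * T)))
    have : Continuous fun c : ℝ => Real.exp (c * T) := by fun_prop
    exact (this.tendsto δ).mono_left nhdsWithin_le_nhds
  refine le_of_tendsto hlim ?_
  filter_upwards [Ioo_mem_nhdsLT hδ] with c hc
  exact hexp c hc.1 hc.2
end

section
/- Consider the planar system dR/dt = f(R,φ) + ε_m·g(R), dφ/dt = ε_e·h(R,φ), where f, h : ℝ² → ℝ and g : ℝ → ℝ are continuously differentiable and ε_m, ε_e > 0, and assume the system generates a global flow on a neighborhood of [0,1]×[0,1]. Let K be a compact subset of the open square (0,1)×(0,1) on which ∂f/∂R > 0. Then there exists ε₀ > 0 such that for all 0 < ε_m, ε_e < ε₀, the set of initial conditions (R₀,φ₀) ∈ K whose forward orbit remains in K for all t ≥ 0 has two-dimensional Lebesgue measure zero. -/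
open MeasureTheory Set

lemma aux_gron {E : Type*} [NormedAddCommGroup E] [NormedSpace ℝ E] {F : E → E} {Q : Set E}
    {M : NNReal} (hLip : LipschitzOnWith M F Q) {x y : ℝ → E} {T : ℝ}
    (hx : ∀ t, HasDerivAt x (F (x t)) t) (hy : ∀ t, HasDerivAt y (F (y t)) t)
    (hxQ : ∀ s ∈ Icc 0 T, x s ∈ Q) (hyQ : ∀ s ∈ Icc 0 T, y s ∈ Q) :
    ∀ t ∈ Icc 0 T, dist (x t) (y t) ≤ dist (x 0) (y 0) * Real.exp (M * t) := by
  intro t ht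
  have := dist_le_of_trajectories_ODE_of_mem (v := fun _ => F) (s := fun _ => Q) (K := M)
    (f := x) (g := y) (a := 0) (b := T) (δ := dist (x 0) (y 0))
    (fun _ _ => hLip) (fun s _ => (hx s).continuousAt.continuousWithinAt)
    (fun s _ => (hx s).hasDerivWithinAt) (fun s hs => hxQ s (Ico_subset_Icc_self hs))
    (fun s _ => (hy s).continuousAt.continuousWithinAt)
    (fun s _ => (hy s).hasDerivWithinAt) (fun s hs => hyQ s (Ico_subset_Icc_self hs)) le_rfl t ht
  simpa using this

lemma aux_approx {E : Type*} [NormedAddCommGroup E] [NormedSpace ℝ E] {F : E → E} {Q : Set E}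
    {M : NNReal} (hLip : LipschitzOnWith M F Q) {x y : ℝ → E} {T : ℝ} (hT : 0 ≤ T)
    (hx : ∀ t, HasDerivAt x (F (x t)) t) (hy : ∀ t, HasDerivAt y (F (y t)) t)
    (hxQ : ∀ s ∈ Icc 0 T, x s ∈ Q) (hyQ : ∀ s ∈ Icc 0 T, y s ∈ Q)
    (hF : Differentiable ℝ F) (D : E →L[ℝ] E) (hD : ‖D‖ ≤ M) {S : Set E} (hS : Convex ℝ S)
    {η : ℝ} (hη : 0 ≤ η) (hSD : ∀ z ∈ S, ‖fderiv ℝ F z - D‖ ≤ η)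
    (hxS : ∀ s ∈ Icc 0 T, x s ∈ S) (hyS : ∀ s ∈ Icc 0 T, y s ∈ S) :
    ‖x T - y T - (ContinuousLinearMap.id ℝ E + T • D) (x 0 - y 0)‖ ≤
      T * (Real.exp (M * T) * (η + M ^ 2 * T)) * ‖x 0 - y 0‖ := by
  have hM : (0:ℝ) ≤ M := M.2
  have h0 : (0:ℝ) ∈ Icc 0 T := ⟨le_rfl, hT⟩
  have hTT : T ∈ Icc 0 T := ⟨hT, le_rfl⟩
  have hg : ∀ s ∈ Icc 0 T, ‖x s - y s‖ ≤ Real.exp (M * T) * ‖x 0 - y 0‖ := by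
    intro s hs
    have h1 := aux_gron hLip hx hy hxQ hyQ s hs
    rw [dist_eq_norm, dist_eq_norm] at h1
    refine h1.trans ?_
    rw [mul_comm]
    gcongr
    exact hs.2
  set e := Real.exp (M * T) with he
  have he0 : 0 ≤ e := (Real.exp_pos _).le
  have hm : ∀ s ∈ Icc 0 T, ‖(x s - y s) - (x 0 - y 0)‖ ≤ M * (e * ‖x 0 - y 0‖) * T := by
    intro s hs
    have := Convex.norm_image_sub_le_of_norm_hasDerivWithin_le (s := Icc 0 T)
      (f := fun s => x s - y s) (f' := fun s => F (x s) - F (y s))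
      (C := M * (e * ‖x 0 - y 0‖))
      (fun s _ => ((hx s).sub (hy s)).hasDerivWithinAt)
      (fun s hs => by
        have h2 := hLip.dist_le_mul _ (hxQ s hs) _ (hyQ s hs)
        rw [dist_eq_norm, dist_eq_norm] at h2
        exact h2.trans (mul_le_mul_of_nonneg_left (hg s hs) hM))
      (convex_Icc 0 T) h0 hs
    refine this.trans ?_
    have h3 : ‖s - 0‖ ≤ T := by
      rw [sub_zero, Real.norm_of_nonneg hs.1]; exact hs.2
    gcongr
  have := Convex.norm_image_sub_le_of_norm_hasDerivWithin_le (s := Icc 0 T)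
      (f := fun s => x s - y s - s • D (x 0 - y 0))
      (f' := fun s => F (x s) - F (y s) - D (x 0 - y 0))
      (C := (e * (η + M ^ 2 * T)) * ‖x 0 - y 0‖)
      (fun s _ => by
        have h4 : HasDerivAt (fun s : ℝ => s • D (x 0 - y 0)) (D (x 0 - y 0)) s := by
          simpa using (hasDerivAt_id s).smul_const (D (x 0 - y 0))
        exact (((hx s).sub (hy s)).sub h4).hasDerivWithinAt)
      (fun s hs => by
        have h5 := Convex.norm_image_sub_le_of_norm_fderiv_le' (𝕜 := ℝ) (f := F) (φ := D) (C := η)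
          (fun z _ => hF z) hSD hS (hyS s hs) (hxS s hs)
        have h6 : F (x s) - F (y s) - D (x 0 - y 0) =
          (F (x s) - F (y s) - D (x s - y s)) + D ((x s - y s) - (x 0 - y 0)) := by
          rw [map_sub D (x s - y s)]; abel
        rw [h6]
        have h7 := (D.le_opNorm ((x s - y s) - (x 0 - y 0))).trans
          (mul_le_mul hD (hm s hs) (norm_nonneg _) hM)
        have h8 := mul_le_mul_of_nonneg_left (hg s hs) hη
        have h9 := norm_add_le (F (x s) - F (y s) - D (x s - y s)) (D ((x s - y s) - (x 0 - y 0)))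
        nlinarith)
      (convex_Icc 0 T) h0 hTT
  have h10 : x T - y T - (ContinuousLinearMap.id ℝ E + T • D) (x 0 - y 0) =
    (x T - y T - T • D (x 0 - y 0)) - (x 0 - y 0 - (0:ℝ) • D (x 0 - y 0)) := by
    simp; abel
  rw [h10]
  refine this.trans (le_of_eq ?_)
  rw [sub_zero, Real.norm_of_nonneg hT]; ring

lemma aux_det (L : ℝ × ℝ →L[ℝ] ℝ × ℝ) :
    L.det = (L (1, 0)).1 * (L (0, 1)).2 - (L (0, 1)).1 * (L (1, 0)).2 := by
  unfold ContinuousLinearMap.det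
  rw [← LinearMap.det_toMatrix (Module.Basis.finTwoProd ℝ), Matrix.det_fin_two]
  simp [LinearMap.toMatrix_apply]

lemma aux_det_ge (L D : ℝ × ℝ →L[ℝ] ℝ × ℝ) {M c t : ℝ} (hc : 0 < c) (ht : 0 < t)
    (hD : ‖D‖ ≤ M) (htr : c ≤ (D (1, 0)).1 + (D (0, 1)).2)
    (hL : ‖L - (ContinuousLinearMap.id ℝ _ + t • D)‖ ≤ t * (c / 4))
    (hsmall : 2 * t * (M + c) ^ 2 ≤ c / 4) : 1 + t * (c / 4) ≤ L.det := by
  have key : ∀ (A : ℝ × ℝ →L[ℝ] ℝ × ℝ) (C : ℝ), ‖A‖ ≤ C →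
      |(A (1, 0)).1| ≤ C ∧ |(A (1, 0)).2| ≤ C ∧ |(A (0, 1)).1| ≤ C ∧ |(A (0, 1)).2| ≤ C := by
    intro A C hA
    have h1 : ‖A (1, 0)‖ ≤ C := by
      have := A.le_opNorm (1, 0)
      simp [Prod.norm_def] at this ⊢
      constructor <;> linarith [this.1, this.2]
    have h2 : ‖A (0, 1)‖ ≤ C := by
      have := A.le_opNorm (0, 1)
      simp [Prod.norm_def] at this ⊢
      constructor <;> linarith [this.1, this.2]
    exact ⟨(norm_fst_le _).trans h1, (norm_snd_le _).trans h1, (norm_fst_le _).trans h2,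
      (norm_snd_le _).trans h2⟩
  obtain ⟨d1, d2, d3, d4⟩ := key D M hD
  obtain ⟨e1, e2, e3, e4⟩ := key _ _ hL
  rw [aux_det]
  simp at e1 e2 e3 e4
  generalize (D (1, 0)).1 = a1 at *
  generalize (D (1, 0)).2 = a2 at *
  generalize (D (0, 1)).1 = a3 at *
  generalize (D (0, 1)).2 = a4 at *
  generalize (L (1, 0)).1 = b1 at *
  generalize (L (1, 0)).2 = b2 at *
  generalize (L (0, 1)).1 = b3 at *
  generalize (L (0, 1)).2 = b4 at *
  have hM : 0 ≤ M := (abs_nonneg _).trans d1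
  have bd : ∀ a u : ℝ, |a| ≤ M → |u - t * a| ≤ t * (c / 4) → |u| ≤ t * (M + c) := by
    intro a u ha hu
    have : |t * a| ≤ t * M := by rw [abs_mul, abs_of_pos ht]; gcongr
    have h2 : |u| ≤ |u - t * a| + |t * a| := by
      simpa using abs_add_le (u - t * a) (t * a)
    nlinarith [mul_pos ht hc]
  have u1 := bd a1 (b1 - 1) d1 (by convert e1 using 2; ring)
  have u2 := bd a2 b2 d2 e2
  have u3 := bd a3 b3 d3 e3
  have u4 := bd a4 (b4 - 1) d4 (by convert e4 using 2; ring)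
  have p1 : |(b1 - 1) * (b4 - 1)| ≤ (t * (M + c)) * (t * (M + c)) := by
    rw [abs_mul]; gcongr
  have p2 : |b3 * b2| ≤ (t * (M + c)) * (t * (M + c)) := by
    rw [abs_mul]; gcongr
  have q1 := neg_le_of_abs_le p1
  have q2 := le_of_abs_le p2
  have q3 := neg_le_of_abs_le e1
  have q4 := neg_le_of_abs_le e4
  have q5 := mul_le_mul_of_nonneg_left hsmall ht.le
  have q6 := mul_le_mul_of_nonneg_left htr ht.le
  nlinarith

lemma aux_closed {F : ℝ × ℝ → ℝ × ℝ} {Q K U : Set (ℝ × ℝ)} {M : NNReal}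
    (hLip : LipschitzOnWith M F Q) (hK : IsClosed K) (hKQ : K ⊆ interior Q) (hQU : Q ⊆ U)
    {Φ : ℝ → ℝ × ℝ → ℝ × ℝ}
    (h0 : ∀ p ∈ U, Φ 0 p = p)
    (hadd : ∀ p ∈ U, ∀ t s : ℝ, Φ (t + s) p = Φ t (Φ s p))
    (hd : ∀ p ∈ U, ∀ t : ℝ, HasDerivAt (fun τ => Φ τ p) (F (Φ t p)) t) :
    IsClosed {p ∈ K | ∀ t : ℝ, 0 ≤ t → Φ t p ∈ K} := by
  set A := {p ∈ K | ∀ t : ℝ, 0 ≤ t → Φ t p ∈ K} with hA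
  have hKU : K ⊆ U := hKQ.trans (interior_subset.trans hQU)
  have hKQ' : K ⊆ Q := hKQ.trans interior_subset
  have hAK : A ⊆ K := fun p hp => hp.1
  have hinv : ∀ p ∈ A, ∀ t, 0 ≤ t → Φ t p ∈ A := by
    intro p hp t ht
    refine ⟨hp.2 t ht, fun s hs => ?_⟩
    rw [← hadd p (hKU hp.1)]
    exact hp.2 _ (by positivity)
  have hcl : closure A ⊆ K := closure_minimal hAK hK
  have step : ∀ p ∈ closure A, ∀ b, 0 < b → ∃ s ∈ Ioc 0 b, Φ s p ∈ closure A := by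
    intro p hp b hb
    have hpK := hcl hp
    have hpU := hKU hpK
    have hcont : ContinuousAt (fun τ => Φ τ p) 0 := (hd p hpU 0).continuousAt
    have hnb : Q ∈ nhds (Φ 0 p) := by
      rw [h0 p hpU]; exact mem_interior_iff_mem_nhds.1 (hKQ hpK)
    obtain ⟨δ, hδ, hδQ⟩ := Metric.mem_nhds_iff.1 (hcont.preimage_mem_nhds hnb)
    set s := min b (δ / 2) with hs
    have hs0 : 0 < s := by positivity
    have hsQ : ∀ τ ∈ Icc 0 s, Φ τ p ∈ Q := by
      intro τ hτ
      apply hδQ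
      rw [Metric.mem_ball, Real.dist_eq, sub_zero, abs_of_nonneg hτ.1]
      have := hτ.2.trans (min_le_right b (δ / 2))
      linarith
    refine ⟨s, ⟨hs0, min_le_left _ _⟩, ?_⟩
    rw [Metric.mem_closure_iff] at hp ⊢
    intro ε hε
    have hE := Real.exp_pos (M * s)
    obtain ⟨q, hqA, hq⟩ := hp (ε / Real.exp (M * s)) (by positivity)
    refine ⟨Φ s q, hinv q hqA s hs0.le, ?_⟩
    have hqU := hKU hqA.1
    have := aux_gron hLip (hd p hpU) (hd q hqU) hsQ
      (fun τ hτ => hKQ' (hqA.2 τ hτ.1)) s ⟨hs0.le, le_rfl⟩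
    simp only [h0 p hpU, h0 q hqU] at this
    rw [lt_div_iff₀ hE] at hq
    exact this.trans_lt hq
  have hsub : closure A ⊆ A := by
    intro p hp
    refine ⟨hcl hp, fun t ht => ?_⟩
    have hpU := hKU (hcl hp)
    have hc : Continuous (fun τ => Φ τ p) :=
      continuous_iff_continuousAt.2 fun τ => (hd p hpU τ).continuousAt
    have hI := IsClosed.Icc_subset_of_forall_exists_gt (a := 0) (b := t)
      (s := (fun τ => Φ τ p) ⁻¹' closure A)
      ((isClosed_closure.preimage hc).inter isClosed_Icc)
      (by simpa [h0 p hpU] using hp)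
      (fun x hx y hy => by
        obtain ⟨s, hs, hsA⟩ := step _ hx.1 (y - x) (sub_pos.2 hy)
        refine ⟨s + x, ?_, ?_, ?_⟩
        · rw [mem_preimage, hadd p hpU]; exact hsA
        · linarith [hs.1]
        · linarith [hs.2])
    exact hcl (hI ⟨ht, le_rfl⟩)
  exact isClosed_of_closure_subset hsub

lemma aux_main {F : ℝ × ℝ → ℝ × ℝ} (hF : ContDiff ℝ 1 F) {Q K U : Set (ℝ × ℝ)}
    (hQc : IsCompact Q) (hQconv : Convex ℝ Q)
    (hK : IsCompact K) (hKQ : K ⊆ interior Q) (hQU : Q ⊆ U) {c : ℝ} (hc : 0 < c)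
    (htr : ∀ p ∈ K, c ≤ (fderiv ℝ F p (1, 0)).1 + (fderiv ℝ F p (0, 1)).2)
    {Φ : ℝ → ℝ × ℝ → ℝ × ℝ}
    (h0 : ∀ p ∈ U, Φ 0 p = p)
    (hadd : ∀ p ∈ U, ∀ t s : ℝ, Φ (t + s) p = Φ t (Φ s p))
    (hd : ∀ p ∈ U, ∀ t : ℝ, HasDerivAt (fun τ => Φ τ p) (F (Φ t p)) t) :
    volume {p ∈ K | ∀ t : ℝ, 0 ≤ t → Φ t p ∈ K} = 0 := by
  have hFd : Differentiable ℝ F := hF.differentiable (by norm_num)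
  have hDF : Continuous (fderiv ℝ F) := hF.continuous_fderiv (by norm_num)
  obtain ⟨M₀, hM₀⟩ := hQc.exists_bound_of_continuousOn hDF.continuousOn
  obtain ⟨B₀, hB₀⟩ := hQc.exists_bound_of_continuousOn hF.continuous.continuousOn
  set M : NNReal := M₀.toNNReal with hMdef
  have hM : ∀ x ∈ Q, ‖fderiv ℝ F x‖ ≤ M := fun x hx => (hM₀ x hx).trans (Real.le_coe_toNNReal _)
  set B : ℝ := max B₀ 0 with hBdef
  have hB : ∀ x ∈ Q, ‖F x‖ ≤ B := fun x hx => (hB₀ x hx).trans (le_max_left _ _)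
  have hB0 : 0 ≤ B := le_max_right _ _
  have hLip : LipschitzOnWith M F Q :=
    hQconv.lipschitzOnWith_of_nnnorm_fderiv_le (𝕜 := ℝ) (fun x _ => hFd x) (fun x hx => hM x hx)
  have hmeas := (aux_closed hLip hK.isClosed hKQ hQU h0 hadd hd).measurableSet
  set A := {p ∈ K | ∀ t : ℝ, 0 ≤ t → Φ t p ∈ K} with hA
  have hKQ' : K ⊆ Q := hKQ.trans interior_subset
  have hKU : K ⊆ U := hKQ'.trans hQU
  have hAK : A ⊆ K := fun p hp => hp.1
  have hinv : ∀ p ∈ A, ∀ t, 0 ≤ t → Φ t p ∈ A := by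
    intro p hp t ht
    refine ⟨hp.2 t ht, fun s hs => ?_⟩
    rw [← hadd p (hKU hp.1)]
    exact hp.2 _ (by positivity)
  have hAfin : volume A ≠ ⊤ := ((measure_mono hAK).trans_lt hK.measure_lt_top).ne
  -- uniform continuity
  have huc := hQc.uniformContinuousOn_of_continuous hDF.continuousOn
  rw [Metric.uniformContinuousOn_iff] at huc
  obtain ⟨r, hr, hur⟩ := huc (c / 8) (by positivity)
  -- choice of time
  obtain ⟨T, hT0, hT1, hT2, hT3⟩ : ∃ T : ℝ, 0 < T ∧
      Real.exp (M * T) * (c / 8 + M ^ 2 * T) < c / 4 ∧ 2 * T * (M + c) ^ 2 < c / 4 ∧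
      B * T < r / 2 := by
    have e1 : ∀ᶠ T : ℝ in nhds 0, Real.exp (M * T) * (c / 8 + M ^ 2 * T) < c / 4 := by
      have : Continuous fun T : ℝ => Real.exp (M * T) * (c / 8 + M ^ 2 * T) := by fun_prop
      exact this.continuousAt.eventually_lt continuousAt_const (by simp; linarith)
    have e2 : ∀ᶠ T : ℝ in nhds 0, 2 * T * (M + c) ^ 2 < c / 4 := by
      have : Continuous fun T : ℝ => 2 * T * (M + c) ^ 2 := by fun_prop
      exact this.continuousAt.eventually_lt continuousAt_const (by simp; linarith)
    have e3 : ∀ᶠ T : ℝ in nhds 0, B * T < r / 2 := by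
      have : Continuous fun T : ℝ => B * T := by fun_prop
      exact this.continuousAt.eventually_lt continuousAt_const (by simp; linarith)
    have e4 : ∀ᶠ T : ℝ in nhdsWithin 0 (Ioi 0), 0 < T := self_mem_nhdsWithin
    obtain ⟨T, h⟩ := (e4.and (((e1.and (e2.and e3))).filter_mono nhdsWithin_le_nhds)).exists
    exact ⟨T, h.1, h.2.1, h.2.2.1, h.2.2.2⟩
  have hstay : ∀ p ∈ A, ∀ s ∈ Icc 0 T, Φ s p ∈ Q := fun p hp s hs => hKQ' (hp.2 s hs.1)
  have hmove : ∀ p ∈ A, ∀ s ∈ Icc 0 T, dist (Φ s p) p < r / 2 := by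
    intro p hp s hs
    have hpU := hKU hp.1
    have := Convex.norm_image_sub_le_of_norm_hasDerivWithin_le (s := Icc 0 T)
      (f := fun s => Φ s p) (f' := fun s => F (Φ s p)) (C := B)
      (fun s _ => (hd p hpU s).hasDerivWithinAt) (fun s hs => hB _ (hstay p hp s hs))
      (convex_Icc 0 T) ⟨le_rfl, hT0.le⟩ hs
    simp only [h0 p hpU] at this
    rw [sub_zero, Real.norm_of_nonneg hs.1, ← dist_eq_norm] at this
    have h2 := mul_le_mul_of_nonneg_left hs.2 hB0
    linarith
  have happ : ∀ p₀ ∈ A, ApproximatesLinearOn (Φ T)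
      (ContinuousLinearMap.id ℝ _ + T • fderiv ℝ F p₀) (A ∩ Metric.ball p₀ (r / 2))
      (T * (c / 4)).toNNReal := by
    intro p₀ hp₀ p hp q hq
    have hp₀Q := hKQ' hp₀.1
    have hball : ∀ x ∈ A ∩ Metric.ball p₀ (r / 2), ∀ s ∈ Icc 0 T,
        Φ s x ∈ Q ∩ Metric.ball p₀ r := by
      intro x hx s hs
      refine ⟨hstay x hx.1 s hs, ?_⟩
      have h1 := hmove x hx.1 s hs
      have h2 := Metric.mem_ball.1 hx.2
      have h3 := dist_triangle (Φ s x) x p₀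
      rw [Metric.mem_ball]; linarith
    have := aux_approx hLip hT0.le (hd p (hKU hp.1.1)) (hd q (hKU hq.1.1)) (hstay p hp.1)
      (hstay q hq.1) hFd (fderiv ℝ F p₀) (hM _ hp₀Q) (hQconv.inter (convex_ball p₀ r))
      (η := c / 8) (by positivity)
      (fun z hz => by
        have := hur z hz.1 p₀ hp₀Q hz.2
        rw [dist_eq_norm] at this; exact this.le)
      (hball p hp) (hball q hq)
    simp only [h0 p (hKU hp.1.1), h0 q (hKU hq.1.1)] at this
    refine this.trans ?_
    rw [Real.coe_toNNReal (T * (c / 4)) (by positivity)]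
    gcongr
  have hlipT : LipschitzOnWith (Real.exp (M * T)).toNNReal (Φ T) A := by
    apply LipschitzOnWith.of_dist_le_mul
    intro p hp q hq
    have := aux_gron hLip (hd p (hKU hp.1)) (hd q (hKU hq.1)) (hstay p hp) (hstay q hq) T
      ⟨hT0.le, le_rfl⟩
    simp only [h0 p (hKU hp.1), h0 q (hKU hq.1)] at this
    rw [Real.coe_toNNReal _ (Real.exp_pos _).le, mul_comm]
    exact this
  have hrad := hlipT.ae_differentiableWithinAt_of_mem (μ := volume)
  obtain ⟨N, hNsub, hNmeas, hN0⟩ := exists_measurable_superset_of_null (ae_iff.1 hrad)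
  set A' := A \ N with hA'
  have hA'meas : MeasurableSet A' := hmeas.diff hNmeas
  have hA'vol : volume A' = volume A := measure_sdiff_null hN0
  have hA'A : A' ⊆ A := sdiff_subset
  have hder : ∀ x ∈ A', HasFDerivWithinAt (Φ T) (fderivWithin ℝ (Φ T) A x) A' x := by
    intro x hx
    have : DifferentiableWithinAt ℝ (Φ T) A x := by
      by_contra hcon
      exact hx.2 (hNsub (fun h => hcon (h hx.1)))
    exact this.hasFDerivWithinAt.mono hA'A
  have hinj : InjOn (Φ T) A' := by
    intro p hp q hq hpq
    have h1 := hadd p (hKU hp.1.1) (-T) T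
    have h2 := hadd q (hKU hq.1.1) (-T) T
    rw [neg_add_cancel, h0 p (hKU hp.1.1)] at h1
    rw [neg_add_cancel, h0 q (hKU hq.1.1)] at h2
    rw [h1, h2, hpq]
  have hdet : ∀ᵐ x ∂(volume.restrict A'), 1 + T * (c / 4) ≤ (fderivWithin ℝ (Φ T) A x).det := by
    obtain ⟨S, hSA, hScount, hScov⟩ : ∃ S ⊆ A, S.Countable ∧
        A ⊆ ⋃ x ∈ S, Metric.ball x (r / 2) := by
      obtain ⟨S, hSA, hSc, hS⟩ := TopologicalSpace.countable_cover_nhdsWithin (s := A)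
        (f := fun x => Metric.ball x (r / 2))
        (fun x _ => mem_nhdsWithin_of_mem_nhds (Metric.ball_mem_nhds x (by positivity)))
      exact ⟨S, hSA, hSc, hS⟩
    have hA'eq : A' = ⋃ x ∈ S, A' ∩ Metric.ball x (r / 2) := by
      rw [← inter_iUnion₂]
      exact (inter_eq_left.2 (hA'A.trans hScov)).symm
    rw [hA'eq, ae_restrict_biUnion_iff _ hScount]
    intro p₀ hp₀
    have hp₀A := hSA hp₀
    have h1 := ((happ p₀ hp₀A).mono_set (inter_subset_inter_left _ hA'A)).norm_fderiv_sub_le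
      volume (hA'meas.inter Metric.isOpen_ball.measurableSet)
      (fun x => fderivWithin ℝ (Φ T) A x)
      (fun x hx => (hder x hx.1).mono inter_subset_left)
    filter_upwards [h1] with x hx
    refine aux_det_ge _ (fderiv ℝ F p₀) hc hT0 (hM _ (hKQ' hp₀A.1)) (htr _ hp₀A.1) ?_ hT2.le
    have hx' : ‖fderivWithin ℝ (Φ T) A x - (ContinuousLinearMap.id ℝ _ + T • fderiv ℝ F p₀)‖ ≤
      ((T * (c / 4)).toNNReal : ℝ) := hx
    rwa [Real.coe_toNNReal _ (by positivity)] at hx'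
  have hint := lintegral_abs_det_fderiv_eq_addHaar_image volume hA'meas hder hinj
  have hlow : ENNReal.ofReal (1 + T * (c / 4)) * volume A ≤ volume A := by
    calc ENNReal.ofReal (1 + T * (c / 4)) * volume A
        = ∫⁻ x in A', ENNReal.ofReal (1 + T * (c / 4)) := by
          rw [setLIntegral_const, hA'vol]
      _ ≤ ∫⁻ x in A', ENNReal.ofReal |(fderivWithin ℝ (Φ T) A x).det| := by
          apply lintegral_mono_ae
          filter_upwards [hdet] with x hx
          exact ENNReal.ofReal_le_ofReal (hx.trans (le_abs_self _))
      _ = volume (Φ T '' A') := hint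
      _ ≤ volume A := by
          apply measure_mono
          rintro _ ⟨p, hp, rfl⟩
          exact hinv p hp.1 T hT0.le
  by_contra hne
  have hpos : 0 < (volume A).toReal := ENNReal.toReal_pos hne hAfin
  have h3 := ENNReal.toReal_mono hAfin hlow
  rw [ENNReal.toReal_mul, ENNReal.toReal_ofReal (by positivity)] at h3
  have : 0 < T * (c / 4) := by positivity
  nlinarith

/-- For the planar system `dR/dt = f(R,φ) + ε_m·g(R)`, `dφ/dt = ε_e·h(R,φ)`
with `f, g, h` continuously differentiable, generating a global flow on a neighborhood of the
unit square, and `K` a compact subset of the open unit square on which `∂f/∂R > 0`, there is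
`ε₀ > 0` such that for all `0 < ε_m, ε_e < ε₀` the set of initial conditions in `K` whose
forward orbit stays in `K` for all `t ≥ 0` has two-dimensional Lebesgue measure zero. -/
theorem stmt_1
    (f h : ℝ × ℝ → ℝ) (g : ℝ → ℝ)
    (hf : ContDiff ℝ 1 f) (hg : ContDiff ℝ 1 g) (hh : ContDiff ℝ 1 h)
    (K : Set (ℝ × ℝ)) (hKcompact : IsCompact K)
    (hKsub : K ⊆ Ioo (0 : ℝ) 1 ×ˢ Ioo (0 : ℝ) 1)
    (hfR : ∀ p ∈ K, 0 < deriv (fun r => f (r, p.2)) p.1) :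
    ∃ ε₀ > 0, ∀ εm εe : ℝ, 0 < εm → εm < ε₀ → 0 < εe → εe < ε₀ →
      ∀ (U : Set (ℝ × ℝ)) (Φ : ℝ → ℝ × ℝ → ℝ × ℝ),
        IsOpen U → (Icc (0 : ℝ) 1 ×ˢ Icc (0 : ℝ) 1) ⊆ U →
        (∀ p ∈ U, ∀ t : ℝ, Φ t p ∈ U) →
        (∀ p ∈ U, Φ 0 p = p) →
        (∀ p ∈ U, ∀ t s : ℝ, Φ (t + s) p = Φ t (Φ s p)) →
        (∀ p ∈ U, ∀ t : ℝ,
          HasDerivAt (fun τ => Φ τ p)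
            (f (Φ t p) + εm * g (Φ t p).1, εe * h (Φ t p)) t) →
        volume {p ∈ K | ∀ t : ℝ, 0 ≤ t → Φ t p ∈ K} = 0 := by
  have hgc : Continuous fun p : ℝ × ℝ => deriv g p.1 :=
    (hg.continuous_deriv (by norm_num)).comp continuous_fst
  have hhc : Continuous fun p : ℝ × ℝ => fderiv ℝ h p (0, 1) :=
    (hh.continuous_fderiv (by norm_num)).clm_apply continuous_const
  have hfc : Continuous fun p : ℝ × ℝ => fderiv ℝ f p (1, 0) :=
    (hf.continuous_fderiv (by norm_num)).clm_apply continuous_const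
  have hfd : Differentiable ℝ f := hf.differentiable (by norm_num)
  have hhd : Differentiable ℝ h := hh.differentiable (by norm_num)
  have hgd : Differentiable ℝ g := hg.differentiable (by norm_num)
  have hfeq : ∀ p : ℝ × ℝ, deriv (fun r => f (r, p.2)) p.1 = fderiv ℝ f p (1, 0) := by
    intro p
    have h1 : HasDerivAt (fun r : ℝ => (r, p.2)) ((1 : ℝ), (0 : ℝ)) p.1 :=
      (hasDerivAt_id p.1).prodMk (hasDerivAt_const p.1 p.2)
    have h2 : HasFDerivAt f (fderiv ℝ f p) (p.1, p.2) := (hfd p).hasFDerivAt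
    exact (h2.comp_hasDerivAt p.1 h1).deriv
  obtain ⟨G, hG⟩ := hKcompact.exists_bound_of_continuousOn hgc.continuousOn
  obtain ⟨H, hH⟩ := hKcompact.exists_bound_of_continuousOn hhc.continuousOn
  obtain ⟨c, hc, hcf⟩ : ∃ c > 0, ∀ p ∈ K, c ≤ fderiv ℝ f p (1, 0) := by
    rcases K.eq_empty_or_nonempty with rfl | hne
    · exact ⟨1, one_pos, fun p hp => hp.elim⟩
    · obtain ⟨p, hp, hmin⟩ := hKcompact.exists_isMinOn hne hfc.continuousOn
      exact ⟨fderiv ℝ f p (1, 0), hfeq p ▸ hfR p hp, fun q hq => hmin hq⟩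
  have hS : 0 < |G| + |H| + 1 := by positivity
  refine ⟨c / 2 / (|G| + |H| + 1), by positivity, ?_⟩
  intro εm εe hm0 hm he0 he U Φ hU hQU hΦU h0 hadd hd
  rw [lt_div_iff₀ hS] at hm he
  set F : ℝ × ℝ → ℝ × ℝ := fun p => (f p + εm * g p.1, εe * h p) with hFdef
  have hF : ContDiff ℝ 1 F :=
    (hf.add (contDiff_const.mul (hg.comp contDiff_fst))).prodMk (contDiff_const.mul hh)
  refine aux_main hF (Q := Icc (0 : ℝ) 1 ×ˢ Icc (0 : ℝ) 1) (isCompact_Icc.prod isCompact_Icc)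
    ((convex_Icc 0 1).prod (convex_Icc 0 1)) hKcompact ?_ hQU (c := c / 2) (by positivity) ?_
    h0 hadd hd
  · rw [interior_prod_eq, interior_Icc]; exact hKsub
  · intro p hp
    have h1 : HasFDerivAt (fun p : ℝ × ℝ => g p.1)
        (deriv g p.1 • ContinuousLinearMap.fst ℝ ℝ ℝ) p :=
      (hgd p.1).hasDerivAt.comp_hasFDerivAt p hasFDerivAt_fst
    have h2 := ((hfd p).hasFDerivAt.add (h1.const_mul εm)).prodMk
      ((hhd p).hasFDerivAt.const_mul εe)
    have h3 : fderiv ℝ F p = _ := h2.fderiv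
    rw [h3]
    simp
    have hg1 := hG p hp
    have hh1 := hH p hp
    have hf1 := hcf p hp
    rw [Real.norm_eq_abs] at hg1 hh1
    have a1 : -|G| ≤ deriv g p.1 := neg_le_of_abs_le (hg1.trans (le_abs_self _))
    have a2 : -|H| ≤ fderiv ℝ h p (0, 1) := neg_le_of_abs_le (hh1.trans (le_abs_self _))
    have b1 := mul_le_mul_of_nonneg_left a1 hm0.le
    have b2 := mul_le_mul_of_nonneg_left a2 he0.le
    rcases le_total εm εe with hle | hle
    · have := mul_le_mul_of_nonneg_right hle (abs_nonneg G)
      nlinarith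
    · have := mul_le_mul_of_nonneg_right hle (abs_nonneg H)
      nlinarith
end

section
/- Let F : ℝ² → ℝ² be a continuously differentiable vector field and Q = [a,b]×[c,d] a closed rectangle on which the divergence of F is strictly positive. Then there is no nonconstant periodic solution of the equation x' = F(x) whose image is contained in Q; that is, there are no T > 0 and nonconstant γ : ℝ → ℝ² with γ'(t) = F(γ(t)) and γ(t+T) = γ(t) for all t, such that γ(t) ∈ Q for all t. -/
open Set

section PartA
open Filter Topology Complex

theorem logint (γ g : ℝ → ℂ) (hγ : ∀ t, HasDerivAt γ (g t) t) (hg : Continuous g)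
    (z κ : ℂ) (hκ : κ ≠ 0) (a b : ℝ) (h : ∀ t ∈ uIcc a b, κ * (γ t - z) ∈ slitPlane) :
    IntervalIntegrable (fun t => g t / (γ t - z)) MeasureTheory.volume a b ∧
    ∫ t in a..b, g t / (γ t - z) = log (κ * (γ b - z)) - log (κ * (γ a - z)) := by
  have hc : Continuous γ := continuous_iff_continuousAt.2 fun t => (hγ t).continuousAt
  have hint : IntervalIntegrable (fun t => g t / (γ t - z)) MeasureTheory.volume a b := by
    apply ContinuousOn.intervalIntegrable
    apply hg.continuousOn.div (by fun_prop)
    intro t ht h0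
    have := slitPlane_ne_zero (h t ht)
    simp [h0] at this
  refine ⟨hint, ?_⟩
  refine intervalIntegral.integral_eq_sub_of_hasDerivAt (f := fun t => log (κ * (γ t - z))) ?_ hint
  intro t ht
  have h1 : HasDerivAt (fun t => κ * (γ t - z)) (κ * g t) t :=
    ((hγ t).sub_const z).const_mul κ
  have h2 := h1.clog_real (h t ht)
  rw [mul_div_mul_left _ _ hκ] at h2
  exact h2

theorem diffint (γ g : ℝ → ℂ) (hγ : ∀ t, HasDerivAt γ (g t) t) (hg : Continuous g)
    (z z0 : ℂ) (a b : ℝ) (h : ∀ t ∈ uIcc a b, ‖z - z0‖ < ‖γ t - z0‖) :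
    ∫ t in a..b, g t / (γ t - z) = (∫ t in a..b, g t / (γ t - z0))
      + (log ((γ b - z) / (γ b - z0)) - log ((γ a - z) / (γ a - z0))) := by
  have hc : Continuous γ := continuous_iff_continuousAt.2 fun t => (hγ t).continuousAt
  have hne0 : ∀ t ∈ uIcc a b, γ t - z0 ≠ 0 := fun t ht =>
    norm_pos_iff.1 ((norm_nonneg _).trans_lt (h t ht))
  have hne : ∀ t ∈ uIcc a b, γ t - z ≠ 0 := by
    intro t ht h0
    have := h t ht
    rw [sub_eq_zero] at h0
    rw [h0] at this
    exact lt_irrefl _ this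
  have hsl : ∀ t ∈ uIcc a b, (γ t - z) / (γ t - z0) ∈ slitPlane := by
    intro t ht
    have h0 := hne0 t ht
    have : (γ t - z) / (γ t - z0) = 1 + (-(z - z0) / (γ t - z0)) := by
      field_simp; ring
    rw [this]
    apply mem_slitPlane_of_norm_lt_one
    rw [norm_div, norm_neg, div_lt_one (norm_pos_iff.2 h0)]
    exact h t ht
  have i1 : IntervalIntegrable (fun t => g t / (γ t - z)) MeasureTheory.volume a b :=
    ContinuousOn.intervalIntegrable (hg.continuousOn.div (by fun_prop) hne)
  have i0 : IntervalIntegrable (fun t => g t / (γ t - z0)) MeasureTheory.volume a b :=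
    ContinuousOn.intervalIntegrable (hg.continuousOn.div (by fun_prop) hne0)
  rw [← sub_eq_iff_eq_add', ← intervalIntegral.integral_sub i1 i0]
  refine intervalIntegral.integral_eq_sub_of_hasDerivAt
    (f := fun t => log ((γ t - z) / (γ t - z0))) ?_ (i1.sub i0)
  intro t ht
  have h2 := ((((hγ t).sub_const z).div ((hγ t).sub_const z0) (hne0 t ht))).clog_real (hsl t ht)
  have e1 := hne t ht
  have e2 := hne0 t ht
  have e3 : g t / (γ t - z) - g t / (γ t - z0) =
      ((g t * (γ t - z0) - (γ t - z) * g t) / (γ t - z0) ^ 2) / ((γ t - z) / (γ t - z0)) := by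
    field_simp
  rw [e3]
  exact h2

theorem log_jump (x : ℂ) (hx : 0 < x.re) : log (I * x) - log (-I * x) = Real.pi * I := by
  have him : 0 < (I * x).im := by simpa using hx
  have h := arg_neg_eq_arg_sub_pi_of_im_pos him
  rw [neg_mul, log, log, h, norm_neg]
  push_cast
  ring

theorem log_jump' (x : ℂ) (hx : x.re < 0) : log (I * x) - log (-I * x) = - (Real.pi * I) := by
  have := log_jump (-x) (by simpa using hx)
  rw [← this]
  simp

theorem exists_region (γ g : ℝ → ℂ) (hγ : ∀ t, HasDerivAt γ (g t) t) (hg : Continuous g)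
    (L : ℝ) (hL : 0 < L) (hγL : γ L = γ 0) (hgL : g L = g 0) (hg0 : g 0 ≠ 0)
    (hinj : ∀ t ∈ Ioo 0 L, γ t ≠ γ 0) (a b c d : ℝ)
    (hre : ∀ t, (γ t).re ∈ Icc a b) (him : ∀ t, (γ t).im ∈ Icc c d) :
    ∃ D : Set ℂ, IsOpen D ∧ D.Nonempty ∧ (∀ z ∈ D, z.re ∈ Icc a b ∧ z.im ∈ Icc c d) ∧
      ∀ S : Set ℂ, IsPreconnected S → (∀ z ∈ S, z ∉ γ '' Icc 0 L) → (S ∩ D).Nonempty → S ⊆ D := by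
  have hc : Continuous γ := continuous_iff_continuousAt.2 fun t => (hγ t).continuousAt
  set K := γ '' Icc 0 L with hK
  have hKc : IsCompact K := isCompact_Icc.image hc
  set W : ℂ → ℂ := fun z => ∫ t in (0:ℝ)..L, g t / (γ t - z) with hW
  have hloc : ∀ z0, z0 ∉ K → ∀ᶠ z in 𝓝 z0, z ∉ K ∧ W z = W z0 := by
    intro z0 hz0
    obtain ⟨r, hr, hrb⟩ := Metric.isOpen_iff.1 hKc.isClosed.isOpen_compl z0 hz0
    filter_upwards [Metric.ball_mem_nhds z0 hr] with z hz
    refine ⟨hrb hz, ?_⟩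
    have := diffint γ g hγ hg z z0 0 L ?_
    · simp only [hW]
      rw [this, hγL]; simp
    · intro t ht
      rw [uIcc_of_le hL.le] at ht
      by_contra hcon
      have : γ t ∈ Metric.ball z0 r := by
        rw [Metric.mem_ball, dist_eq_norm] at *
        linarith
      exact hrb this ⟨t, ht, rfl⟩
  have hopen : ∀ P : ℂ → Prop, IsOpen {z | z ∉ K ∧ P (W z)} := by
    intro P
    rw [isOpen_iff_mem_nhds]
    rintro z0 ⟨h1, h2⟩
    filter_upwards [hloc z0 h1] with z hz
    exact ⟨hz.1, by rw [hz.2]; exact h2⟩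
  have hout : ∀ z κ : ℂ, κ ≠ 0 → (∀ t, 0 < (κ * (γ t - z)).re) → W z = 0 := by
    intro z κ hκ h
    have := (logint γ g hγ hg z κ hκ 0 L (fun t _ => Or.inl (h t))).2
    simp only [hW]
    rw [this, hγL]; simp
  refine ⟨{z | z ∉ K ∧ W z ≠ 0}, hopen (fun w => w ≠ 0), ?_, ?_, ?_⟩
  · by_contra hemp
    have hzero : ∀ z, z ∉ K → W z = 0 := by
      intro z hz
      by_contra h
      exact hemp ⟨z, hz, h⟩
    set p := γ 0 with hp
    set v := g 0 with hv
    set q : ℝ → ℂ := fun t => (γ t - p) / v with hq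
    have hqd : ∀ t, HasDerivAt q (g t / v) t := fun t => ((hγ t).sub_const p).div_const v
    have hqr : ∀ t, HasDerivAt (fun t => (q t).re) (g t / v).re t := fun t =>
      (reCLM.hasFDerivAt.comp_hasDerivAt t (hqd t))
    have hg1 : Continuous (fun t => (g t / v).re) := by fun_prop
    have hq0 : q 0 = 0 := by simp [hq, hp]
    have hqL : q L = 0 := by simp [hq, hγL]
    -- choose δ
    have e0 : ∀ᶠ t in 𝓝 (0:ℝ), 0 < (g t / v).re := by
      apply hg1.continuousAt.eventually (lt_mem_nhds _)
      simp only [← hv]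
      rw [div_self hg0]; simp
    have eL : ∀ᶠ t in 𝓝 L, 0 < (g t / v).re := by
      apply hg1.continuousAt.eventually (lt_mem_nhds _)
      simp only [hgL]
      rw [div_self hg0]; simp
    obtain ⟨r0, hr0, hb0⟩ := Metric.eventually_nhds_iff.1 e0
    obtain ⟨r1, hr1, hb1⟩ := Metric.eventually_nhds_iff.1 eL
    obtain ⟨δ, hδ, hδ0, hδ1, hδL⟩ : ∃ δ : ℝ, 0 < δ ∧ δ < r0 ∧ δ < r1 ∧ δ < L / 2 := by
      obtain ⟨δ, h1, h2⟩ := exists_between (lt_min (lt_min hr0 hr1) (half_pos hL))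
      exact ⟨δ, h1, by simp at h2; tauto, by simp at h2; tauto, by simp at h2; tauto⟩
    have m0 : StrictMonoOn (fun t => (q t).re) (Icc 0 δ) := by
      apply strictMonoOn_of_deriv_pos (convex_Icc _ _)
      · exact fun t _ => (hqr t).continuousAt.continuousWithinAt
      · intro t ht
        rw [interior_Icc] at ht
        rw [(hqr t).deriv]
        apply hb0
        rw [Real.dist_eq, abs_lt]; constructor <;> linarith [ht.1, ht.2]
    have m1 : StrictMonoOn (fun t => (q t).re) (Icc (L - δ) L) := by
      apply strictMonoOn_of_deriv_pos (convex_Icc _ _)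
      · exact fun t _ => (hqr t).continuousAt.continuousWithinAt
      · intro t ht
        rw [interior_Icc] at ht
        rw [(hqr t).deriv]
        apply hb1
        rw [Real.dist_eq, abs_lt]; constructor <;> linarith [ht.1, ht.2]
    have n0 : ∀ t ∈ Icc 0 δ, q t = 0 ∨ 0 < (q t).re := by
      intro t ht
      rcases ht.1.eq_or_lt with h | h
      · left; rw [← h, hq0]
      · right
        have := m0 ⟨le_rfl, hδ.le⟩ ht h
        simpa [hq0] using this
    have n1 : ∀ t ∈ Icc (L - δ) L, q t = 0 ∨ (q t).re < 0 := by
      intro t ht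
      rcases ht.2.eq_or_lt with h | h
      · left; rw [h, hqL]
      · right
        have := m1 ht ⟨by linarith, le_rfl⟩ h
        simpa [hqL] using this
    have q1 : 0 < (q δ).re := by
      have := m0 ⟨le_rfl, hδ.le⟩ ⟨hδ.le, le_rfl⟩ hδ
      simpa [hq0] using this
    have q2 : (q (L - δ)).re < 0 := by
      have := m1 ⟨le_rfl, by linarith⟩ ⟨by linarith, le_rfl⟩ (by linarith : L - δ < L)
      simpa [hqL] using this
    -- middle distance
    obtain ⟨ρ, hρ, hρb⟩ : ∃ ρ > 0, ∀ t ∈ Icc δ (L - δ), ρ ≤ ‖γ t - p‖ := by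
      have hcomp : IsCompact (Icc δ (L - δ)) := isCompact_Icc
      have hf : Continuous fun t => ‖γ t - p‖ := by fun_prop
      obtain ⟨t0, ht0, hmin⟩ := hcomp.exists_isMinOn ⟨δ, le_rfl, by linarith⟩ hf.continuousOn
      refine ⟨‖γ t0 - p‖, ?_, fun t ht => hmin ht⟩
      rw [gt_iff_lt, norm_pos_iff, sub_ne_zero]
      exact hinj t0 ⟨by linarith [ht0.1], by linarith [ht0.2]⟩
    -- general formula, σ = ±I
    have key : ∀ σ : ℂ, (σ = I ∨ σ = -I) → ∀ ε : ℝ, 0 < ε → ε * ‖v‖ < ρ →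
        0 = (log (σ * q δ + ε) - log (σ * q (L - δ) + ε))
          + ((∫ t in δ..(L - δ), g t / (γ t - p)) +
            (log ((γ (L-δ) - (p + σ * ε * v)) / (γ (L-δ) - p))
              - log ((γ δ - (p + σ * ε * v)) / (γ δ - p)))) := by
      intro σ hσ ε hε hερ
      set z := p + σ * ε * v with hz
      have hσ2 : σ * σ = -1 := by rcases hσ with h | h <;> simp [h]
      have hσn : ‖σ‖ = 1 := by rcases hσ with h | h <;> simp [h]
      have hσ0 : σ ≠ 0 := by rw [← norm_pos_iff, hσn]; norm_num
      have hκ : ∀ t, σ / v * (γ t - z) = σ * q t + ε := by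
        intro t
        simp only [hq, hz]
        field_simp
        linear_combination (-(ε:ℂ) * v) * hσ2
      have hsl : ∀ t, t ∈ Icc 0 δ ∪ Icc (L - δ) L → σ / v * (γ t - z) ∈ slitPlane := by
        intro t ht
        rw [hκ]
        have : q t = 0 ∨ (q t).re ≠ 0 := by
          rcases ht with ht | ht
          · exact (n0 t ht).imp id ne_of_gt
          · exact (n1 t ht).imp id ne_of_lt
        rcases this with h | h
        · left; simp [h, hε]
        · right
          rcases hσ with h' | h' <;> simp [h', h]
      have hzK : z ∉ K := by
        rintro ⟨t, ht, htz⟩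
        by_cases h1 : t ∈ Icc 0 δ ∪ Icc (L - δ) L
        · have := slitPlane_ne_zero (hsl t h1)
          simp [htz] at this
        · simp only [mem_union, mem_Icc, not_or, not_and, not_le] at h1
          have h2 := hρb t ⟨(h1.1 ht.1).le, by
            by_contra h3
            have := h1.2 (by linarith)
            linarith [ht.2]⟩
          rw [htz, hz] at h2
          simp [hσn, abs_of_pos hε] at h2
          linarith
      have hk0 : σ / v ≠ 0 := div_ne_zero hσ0 hg0
      obtain ⟨i1, e1⟩ := logint γ g hγ hg z (σ / v) hk0 0 δ
        (fun t ht => hsl t (Or.inl (by rwa [uIcc_of_le hδ.le] at ht)))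
      obtain ⟨i3, e3⟩ := logint γ g hγ hg z (σ / v) hk0 (L - δ) L
        (fun t ht => hsl t (Or.inr (by rwa [uIcc_of_le (by linarith)] at ht)))
      have hzp : ‖z - p‖ = ε * ‖v‖ := by
        rw [hz, add_sub_cancel_left, norm_mul, norm_mul, hσn]; simp [abs_of_pos hε]
      have e2 := diffint γ g hγ hg z p δ (L - δ) (fun t ht => by
        rw [uIcc_of_le (by linarith)] at ht
        rw [hzp]; exact hερ.trans_le (hρb t ht))
      have i2 : IntervalIntegrable (fun t => g t / (γ t - z)) MeasureTheory.volume δ (L - δ) := by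
        apply ContinuousOn.intervalIntegrable (hg.continuousOn.div (by fun_prop) _)
        intro t ht h0
        rw [uIcc_of_le (by linarith)] at ht
        exact hzK ⟨t, ⟨by linarith [ht.1], by linarith [ht.2]⟩, sub_eq_zero.1 h0⟩
      have hWz := hzero z hzK
      simp only [hW] at hWz
      rw [← intervalIntegral.integral_add_adjacent_intervals (i1.trans i2) i3,
        ← intervalIntegral.integral_add_adjacent_intervals i1 i2, e1, e2, e3] at hWz
      rw [hκ, hκ, hκ, hκ, hq0, hqL] at hWz
      rw [← hWz]; ring
    have lim : ∀ σ : ℂ, (σ = I ∨ σ = -I) → 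
        0 = (log (σ * q δ) - log (σ * q (L - δ))) + (∫ t in δ..(L - δ), g t / (γ t - p)) := by
      intro σ hσ
      have hne1 : γ δ - p ≠ 0 := sub_ne_zero.2 (hinj δ ⟨hδ, by linarith⟩)
      have hne2 : γ (L - δ) - p ≠ 0 := sub_ne_zero.2 (hinj (L - δ) ⟨by linarith, by linarith⟩)
      have ht : Tendsto (fun ε : ℝ => (log (σ * q δ + ε) - log (σ * q (L - δ) + ε))
          + ((∫ t in δ..(L - δ), g t / (γ t - p)) +
            (log ((γ (L-δ) - (p + σ * ε * v)) / (γ (L-δ) - p))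
              - log ((γ δ - (p + σ * ε * v)) / (γ δ - p))))) (𝓝[>] 0)
          (𝓝 ((log (σ * q δ + (0:ℝ)) - log (σ * q (L - δ) + (0:ℝ)))
          + ((∫ t in δ..(L - δ), g t / (γ t - p)) +
            (log ((γ (L-δ) - (p + σ * (0:ℝ) * v)) / (γ (L-δ) - p))
              - log ((γ δ - (p + σ * (0:ℝ) * v)) / (γ δ - p)))))) := by
        apply tendsto_nhdsWithin_of_tendsto_nhds
        refine Tendsto.add (Tendsto.sub ?_ ?_) (Tendsto.add tendsto_const_nhds
          (Tendsto.sub ?_ ?_))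
        · refine Tendsto.clog (Continuous.tendsto (by fun_prop) 0) ?_
          right
          rcases hσ with h' | h' <;> simp [h', q1.ne']
        · refine Tendsto.clog (Continuous.tendsto (by fun_prop) 0) ?_
          right
          rcases hσ with h' | h' <;> simp [h', q2.ne]
        · refine Tendsto.clog (Continuous.tendsto (by fun_prop) 0) ?_
          left
          simp [hne2]
        · refine Tendsto.clog (Continuous.tendsto (by fun_prop) 0) ?_
          left
          simp [hne1]
      have hev : ∀ᶠ ε : ℝ in 𝓝[>] 0, 0 < ε ∧ ε * ‖v‖ < ρ := by
        refine (eventually_mem_nhdsWithin).and (tendsto_nhdsWithin_of_tendsto_nhds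
          (Continuous.tendsto (f := fun ε : ℝ => ε * ‖v‖) (by fun_prop) 0) |>.eventually
            (gt_mem_nhds (by simpa using hρ)))
      have ht0 : Tendsto (fun ε : ℝ => (0:ℂ)) (𝓝[>] (0:ℝ)) _ :=
        ht.congr' (hev.mono fun ε hε => (key σ hσ ε hε.1 hε.2).symm)
      have := tendsto_nhds_unique ht0 tendsto_const_nhds
      rw [← this]
      simp [hne1, hne2]
    have l1 := lim I (Or.inl rfl)
    have l2 := lim (-I) (Or.inr rfl)
    have j1 := log_jump _ q1
    have j2 := log_jump' _ q2
    have : (Real.pi : ℂ) * I = 0 := by linear_combination (-1/2) * (l1 - l2 + j1 - j2)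
    simp [Real.pi_ne_zero] at this
  · rintro z ⟨-, hz⟩
    refine ⟨⟨?_, ?_⟩, ⟨?_, ?_⟩⟩ <;> by_contra! h <;> apply hz
    · exact hout z 1 one_ne_zero fun t => by simpa using by linarith [(hre t).1]
    · exact hout z (-1) (by simp) fun t => by simpa using by linarith [(hre t).2]
    · exact hout z (-I) (by simp) fun t => by simpa using by linarith [(him t).1]
    · exact hout z I (by simp) fun t => by simpa using by linarith [(him t).2]
  · intro S hS hSK hSD
    have := hS.subset_left_of_subset_union (hopen (fun w => w ≠ 0)) (hopen (fun w => w = 0)) ?_ ?_ hSD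
    · exact this
    · rw [Set.disjoint_left]
      rintro z ⟨_, h1⟩ ⟨_, h2⟩
      exact h1 h2
    · intro z hz
      by_cases h : W z = 0
      · right; exact ⟨hSK z hz, h⟩
      · left; exact ⟨hSK z hz, h⟩

end PartA

section PartB
open Filter Topology MeasureTheory

theorem det_one_add (A : (ℝ × ℝ) →L[ℝ] ℝ × ℝ) (h : ℝ) :
    (ContinuousLinearMap.id ℝ (ℝ × ℝ) + h • A).det =
      1 + h * LinearMap.trace ℝ (ℝ × ℝ) (A : (ℝ × ℝ) →ₗ[ℝ] ℝ × ℝ) + h ^ 2 * A.det := by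
  unfold ContinuousLinearMap.det
  rw [← LinearMap.det_toMatrix (Module.Basis.finTwoProd ℝ),
    ← LinearMap.det_toMatrix (Module.Basis.finTwoProd ℝ) (A : (ℝ × ℝ) →ₗ[ℝ] ℝ × ℝ),
    LinearMap.trace_eq_matrix_trace ℝ (Module.Basis.finTwoProd ℝ)]
  rw [Matrix.det_fin_two, Matrix.det_fin_two]
  simp [Matrix.trace_fin_two, LinearMap.toMatrix_apply]
  ring

theorem trace_cont (F : ℝ × ℝ → ℝ × ℝ) (hF : ContDiff ℝ 1 F) : Continuous fun x =>
    LinearMap.trace ℝ (ℝ × ℝ) (fderiv ℝ F x : (ℝ × ℝ) →ₗ[ℝ] ℝ × ℝ) := by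
  have h : Continuous (fderiv ℝ F) := hF.continuous_fderiv one_ne_zero
  have : ∀ A : (ℝ × ℝ) →L[ℝ] ℝ × ℝ, LinearMap.trace ℝ (ℝ × ℝ) (A : (ℝ × ℝ) →ₗ[ℝ] ℝ × ℝ)
      = (A (1, 0)).1 + (A (0, 1)).2 := by
    intro A
    rw [LinearMap.trace_eq_matrix_trace ℝ (Module.Basis.finTwoProd ℝ)]
    simp [Matrix.trace_fin_two, LinearMap.toMatrix_apply]
  simp_rw [this]
  fun_prop

theorem nbhd_vol (γ : ℝ → ℝ × ℝ) (T M : ℝ) (hT : 0 < T) (hper : ∀ t, γ (t + T) = γ t)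
    (hM : 0 ≤ M) (hlip : ∀ s t, ‖γ s - γ t‖ ≤ M * |s - t|) (k : ℝ) (hk : 0 ≤ k) (n : ℕ) (hn : 0 < n) :
    volume {y | ∃ t, ‖y - γ t‖ ≤ k / (n:ℝ) ^ 2} ≤
      ENNReal.ofReal (8 * (k + M * T) ^ 2 / (n:ℝ) ^ 2) := by
  have hnR : (0:ℝ) < n := by exact_mod_cast hn
  have hn1 : (1:ℝ) ≤ n := by exact_mod_cast hn
  set C := k + M * T
  have hC : 0 ≤ C := by positivity
  set N := n ^ 2 + 1 with hN
  have hsub : {y | ∃ t, ‖y - γ t‖ ≤ k / (n:ℝ) ^ 2} ⊆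
      ⋃ i ∈ Finset.range N, Metric.closedBall (γ (i * T / (n:ℝ)^2)) (C / (n:ℝ)^2) := by
    rintro y ⟨t', ht'⟩
    have hp : Function.Periodic γ T := hper
    obtain ⟨t, ht, hte⟩ := hp.exists_mem_Ico₀ hT t'
    rw [hte] at ht'
    simp only [mem_iUnion, Finset.mem_range, exists_prop]
    have hx : 0 ≤ t * n ^ 2 / T := by have := ht.1; positivity
    have f1 := Nat.floor_le hx
    have f2 := Nat.lt_floor_add_one (t * n ^ 2 / T)
    have hnT : (0:ℝ) < n ^ 2 / T := by positivity
    refine ⟨⌊t * n ^ 2 / T⌋₊, ?_, ?_⟩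
    · have : t * n ^ 2 / T < n ^ 2 := by
        rw [div_lt_iff₀ hT]
        have := ht.2
        rw [mul_comm]; gcongr
      have : ((⌊t * n ^ 2 / T⌋₊ : ℕ) : ℝ) < ((n ^ 2 + 1 : ℕ) : ℝ) := by push_cast; linarith
      exact_mod_cast this
    · set i := ⌊t * n ^ 2 / T⌋₊
      have habs : |t - i * T / n ^ 2| ≤ T / n ^ 2 := by
        have e : t = (t * n ^ 2 / T) * (T / n ^ 2) := by field_simp
        have e2 : (i:ℝ) * T / n ^ 2 = i * (T / n ^ 2) := by ring
        have hp : 0 < T / (n:ℝ) ^ 2 := by positivity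
        rw [e2]
        generalize t * n ^ 2 / T = x at *
        rw [e, ← sub_mul, abs_mul, abs_of_pos hp]
        have : |x - i| ≤ 1 := by rw [abs_le]; constructor <;> linarith
        nlinarith
      rw [Metric.mem_closedBall, dist_eq_norm]
      calc ‖y - γ (i * T / n ^ 2)‖ = ‖(y - γ t) + (γ t - γ (i * T / n ^ 2))‖ := by congr 1; abel
        _ ≤ ‖y - γ t‖ + ‖γ t - γ (i * T / n ^ 2)‖ := norm_add_le _ _
        _ ≤ k / n ^ 2 + M * (T / n ^ 2) := by
            refine add_le_add ht' ((hlip _ _).trans ?_)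
            gcongr
        _ = C / n ^ 2 := by simp only [C]; ring
  refine (measure_mono hsub).trans ((measure_biUnion_finset_le _ _).trans ?_)
  have hball : ∀ x : ℝ × ℝ, volume (Metric.closedBall x (C / (n:ℝ)^2)) =
      ENNReal.ofReal ((2 * (C / (n:ℝ)^2)) ^ 2) := by
    intro x
    rw [← Prod.mk.eta (p := x), ← closedBall_prod_same, Measure.volume_eq_prod, Measure.prod_prod,
      Real.volume_closedBall, Real.volume_closedBall, ← ENNReal.ofReal_mul (by positivity), pow_two (2 * (C / (n:ℝ)^2))]
  simp_rw [hball]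
  rw [Finset.sum_const, Finset.card_range, nsmul_eq_mul, ← ENNReal.ofReal_natCast,
    ← ENNReal.ofReal_mul (by positivity)]
  apply ENNReal.ofReal_le_ofReal
  rw [hN]; push_cast
  have : ((n:ℝ)^2 + 1) ≤ 2 * n ^ 2 := by nlinarith
  calc ((n:ℝ)^2 + 1) * (2 * (C / n ^ 2)) ^ 2 ≤ (2 * n ^ 2) * (2 * (C / n ^ 2)) ^ 2 := by gcongr
    _ = 8 * C ^ 2 / n ^ 2 := by field_simp; ring

theorem euler (F : ℝ × ℝ → ℝ × ℝ) (hF : ContDiff ℝ 1 F) (Q : Set (ℝ × ℝ)) (hQ : IsCompact Q)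
    (hconv : Convex ℝ Q)
    (hdiv : ∀ x ∈ Q, 0 < LinearMap.trace ℝ (ℝ × ℝ) (fderiv ℝ F x : (ℝ × ℝ) →ₗ[ℝ] ℝ × ℝ))
    (T : ℝ) (γ : ℝ → ℝ × ℝ) (hT : 0 < T) (hγ : ∀ t, HasDerivAt γ (F (γ t)) t)
    (hper : ∀ t, γ (t + T) = γ t) (hγQ : ∀ t, γ t ∈ Q)
    (D : Set (ℝ × ℝ)) (hDo : IsOpen D) (hDn : D.Nonempty) (hDQ : D ⊆ Q)
    (hD : ∀ x ∈ D, ∀ y, y ∉ D → ∃ z ∈ segment ℝ x y, ∃ t, z = γ t) : False := by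
  have hQn : Q.Nonempty := hDn.mono hDQ
  obtain ⟨M, hM⟩ := hQ.exists_bound_of_continuousOn hF.continuous.continuousOn
  have hM0 : 0 ≤ M := (norm_nonneg _).trans (hM _ (hγQ 0))
  have hfd : Continuous (fderiv ℝ F) := hF.continuous_fderiv one_ne_zero
  obtain ⟨k, hk⟩ := hQ.exists_bound_of_continuousOn hfd.continuousOn
  have hk0 : 0 ≤ k := (norm_nonneg _).trans (hk _ (hγQ 0))
  have hdc : Continuous fun x => (fderiv ℝ F x).det := ContinuousLinearMap.continuous_det.comp hfd
  obtain ⟨B, hB⟩ := hQ.exists_bound_of_continuousOn hdc.continuousOn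
  obtain ⟨x0, hx0, hmin⟩ := hQ.exists_isMinOn hQn (trace_cont F hF).continuousOn
  set m := LinearMap.trace ℝ (ℝ × ℝ) (fderiv ℝ F x0 : (ℝ × ℝ) →ₗ[ℝ] ℝ × ℝ) with hm
  have hm0 : 0 < m := hdiv x0 hx0
  have hB0 : 0 ≤ B := (norm_nonneg _).trans (hB _ (hγQ 0))
  have hdiff : Differentiable ℝ F := hF.differentiable one_ne_zero
  have hFl : ∀ x ∈ Q, ∀ y ∈ Q, ‖F y - F x‖ ≤ k * ‖y - x‖ := fun x hx y hy =>
    hconv.norm_image_sub_le_of_norm_fderiv_le (fun z _ => hdiff z) hk hx hy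
  have hlip : ∀ s t, ‖γ s - γ t‖ ≤ M * |s - t| := by
    intro s t
    exact convex_univ.norm_image_sub_le_of_norm_hasDerivWithin_le
      (fun u _ => (hγ u).hasDerivWithinAt) (fun u _ => hM _ (hγQ u)) (mem_univ t) (mem_univ s)
  have htaylor : ∀ t u : ℝ, 0 ≤ u → ‖γ (t + u) - γ t - u • F (γ t)‖ ≤ k * M * u ^ 2 := by
    intro t u hu
    have hd : ∀ s, HasDerivAt (fun s => γ (t + s) - s • F (γ t)) (F (γ (t + s)) - F (γ t)) s := by
      intro s
      have h1 := (hγ (t + s)).comp_const_add t s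
      have h2 := (hasDerivAt_id s).smul_const (F (γ t))
      have h3 := h1.sub h2
      rw [one_smul] at h3
      exact h3
    have := (convex_Icc (0:ℝ) u).norm_image_sub_le_of_norm_hasDerivWithin_le (C := k * (M * u))
      (fun s _ => (hd s).hasDerivWithinAt) (fun s hs => by
        refine (hFl _ (hγQ _) _ (hγQ _)).trans ?_
        gcongr
        refine (hlip _ _).trans ?_
        rw [add_sub_cancel_left, abs_of_nonneg hs.1]
        gcongr
        exact hs.2) (left_mem_Icc.2 hu) (right_mem_Icc.2 hu)
    simp only [add_zero, zero_smul, sub_zero, Real.norm_eq_abs, abs_of_nonneg hu] at this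
    calc _ = ‖γ (t + u) - u • F (γ t) - γ t‖ := by congr 1; abel
      _ ≤ _ := this
      _ = _ := by ring
  set V := (volume D).toReal with hV
  have hDfin : volume D ≠ ⊤ := ((measure_mono hDQ).trans_lt hQ.measure_lt_top).ne
  have hVpos : 0 < V := ENNReal.toReal_pos (hDo.measure_pos volume hDn).ne' hDfin
  set C := 2 * k * M + M * T with hC
  have main : ∀ n : ℕ, k < n → B < n → V * (m - B / n) ≤ 8 * C ^ 2 / n := by
    intro n hkn hBn
    have hnR : (0:ℝ) < n := hk0.trans_lt hkn
    have hn : 0 < n := by exact_mod_cast hnR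
    have hn1 : (1:ℝ) ≤ n := by exact_mod_cast hn
    set h : ℝ := 1 / n with hh
    have hh0 : 0 < h := by positivity
    set φ : ℝ × ℝ → ℝ × ℝ := fun x => x + h • F x with hφ
    have hφd : ∀ x, HasFDerivAt φ (ContinuousLinearMap.id ℝ (ℝ × ℝ) + h • fderiv ℝ F x) x :=
      fun x => (hasFDerivAt_id x).add ((hdiff x).hasFDerivAt.const_smul h)
    have hinj : InjOn φ D := by
      intro x hx y hy hxy
      have h1 : y - x = -(h • (F y - F x)) := by
        simp only [hφ] at hxy
        rw [smul_sub]
        have : y - x = (y + h • F y) - (x + h • F x) - (h • F y - h • F x) := by abel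
        rw [this, hxy]; abel
      have h2 := hFl x (hDQ hx) y (hDQ hy)
      have h3 : ‖y - x‖ = h * ‖F y - F x‖ := by
        rw [h1, norm_neg, norm_smul, Real.norm_of_nonneg hh0.le]
      have h4 : h * k < 1 := by rw [hh, one_div, inv_mul_lt_one₀ hnR]; exact hkn
      have h5 : ‖y - x‖ ≤ h * k * ‖y - x‖ := by rw [mul_assoc]; nlinarith
      have h6 : ‖y - x‖ = 0 := by
        by_contra hne
        have : 0 < ‖y - x‖ := lt_of_le_of_ne (norm_nonneg _) (Ne.symm hne)
        nlinarith
      exact (sub_eq_zero.1 (norm_eq_zero.1 h6)).symm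
    have himg : φ '' D ⊆ D ∪ {y | ∃ t, ‖y - γ t‖ ≤ (2 * k * M) / (n:ℝ) ^ 2} := by
      rintro _ ⟨x, hx, rfl⟩
      by_cases hy : φ x ∈ D
      · exact Or.inl hy
      right
      obtain ⟨z, hz, t, hzt⟩ := hD x hx _ hy
      rw [segment_eq_image'] at hz
      obtain ⟨θ, hθ, rfl⟩ := hz
      simp only [hφ, add_sub_cancel_left] at hzt
      set s := θ * h
      have hs0 : 0 ≤ s := mul_nonneg hθ.1 hh0.le
      have hs1 : s ≤ h := mul_le_of_le_one_left hh0.le hθ.2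
      rw [smul_smul] at hzt
      have hx' : x - γ t = -(s • F x) := by rw [← hzt]; abel
      have hFx : ‖F x - F (γ t)‖ ≤ k * (M * h) := by
        refine (hFl _ (hγQ t) _ (hDQ hx)).trans ?_
        rw [hx', norm_neg, norm_smul, Real.norm_of_nonneg hs0, mul_comm s]
        gcongr
        exact hM _ (hDQ hx)
      refine ⟨t + (h - s), ?_⟩
      have hu : 0 ≤ h - s := by linarith
      have e : φ x - γ (t + (h - s)) = (h - s) • (F x - F (γ t))
          - (γ (t + (h - s)) - γ t - (h - s) • F (γ t)) := by
        simp only [hφ]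
        rw [← hzt]
        module
      rw [e]
      refine (norm_sub_le _ _).trans ?_
      have t1 := htaylor t (h - s) hu
      have t2 : ‖(h - s) • (F x - F (γ t))‖ ≤ h * (k * (M * h)) := by
        rw [norm_smul, Real.norm_of_nonneg hu]
        gcongr
        linarith
      have t3 : k * M * (h - s) ^ 2 ≤ k * M * h ^ 2 := by gcongr; linarith
      have : 2 * k * M / (n:ℝ)^2 = h * (k * (M * h)) + k * M * h ^ 2 := by rw [hh]; field_simp; ring
      rw [this]; linarith
    have hcov := lintegral_abs_det_fderiv_eq_addHaar_image volume hDo.measurableSet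
      (fun x _ => (hφd x).hasFDerivWithinAt) hinj
    set lam := 1 + h * m - h ^ 2 * B with hlam
    have hlow : ENNReal.ofReal lam * volume D ≤ volume (φ '' D) := by
      rw [← hcov, ← setLIntegral_const]
      apply setLIntegral_mono' hDo.measurableSet
      intro x hx
      apply ENNReal.ofReal_le_ofReal
      refine le_trans ?_ (le_abs_self _)
      rw [det_one_add, hlam]
      have b1 : m ≤ _ := hmin (hDQ hx)
      have b2 := abs_le.1 (hB x (hDQ hx))
      have := b2.1
      simp only [] at b1
      nlinarith [mul_le_mul_of_nonneg_left b1 hh0.le, mul_le_mul_of_nonneg_left b2.1 (sq_nonneg h)]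
    have hup := hlow.trans ((measure_mono himg).trans (measure_union_le _ _))
    have hnv := nbhd_vol γ T M hT hper hM0 hlip (2 * k * M) (by positivity) n hn
    have hup2 := hup.trans (add_le_add_right hnv _)
    have hl0 : 0 ≤ lam := by
      have : h ^ 2 * B ≤ 1 := by
        rw [hh]; field_simp; nlinarith
      have := mul_pos hh0 hm0
      linarith
    rw [← ENNReal.ofReal_toReal hDfin, ← ENNReal.ofReal_mul hl0,
      ← ENNReal.ofReal_add ENNReal.toReal_nonneg (by positivity),
      ENNReal.ofReal_le_ofReal_iff (by positivity)] at hup2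
    rw [← hV, ← hC] at hup2
    have hfin : h * (V * (m - B / n)) ≤ h * (8 * C ^ 2 / n) := by
      have e1 : h * (V * (m - B / n)) = lam * V - V := by rw [hlam, hh]; ring
      have e2 : h * (8 * C ^ 2 / n) = 8 * C ^ 2 / n ^ 2 := by rw [hh]; ring
      rw [e1, e2]; linarith
    exact le_of_mul_le_mul_left hfin hh0
  have t1 : Tendsto (fun n : ℕ => V * (m - B / n)) atTop (𝓝 (V * (m - 0))) :=
    (tendsto_const_nhds.sub (tendsto_const_div_atTop_nhds_zero_nat B)).const_mul V
  have t2 : Tendsto (fun n : ℕ => 8 * C ^ 2 / (n:ℝ)) atTop (𝓝 0) :=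
    tendsto_const_div_atTop_nhds_zero_nat _
  have hev : ∀ᶠ n : ℕ in atTop, k < n ∧ B < n :=
    (tendsto_natCast_atTop_atTop.eventually_gt_atTop k).and
      (tendsto_natCast_atTop_atTop.eventually_gt_atTop B)
  have := le_of_tendsto_of_tendsto t1 t2 (hev.mono fun n hn => main n hn.1 hn.2)
  have := mul_pos hVpos hm0
  simp at *
  linarith

end PartB


theorem bend_aux
    (F : ℝ × ℝ → ℝ × ℝ) (hF : ContDiff ℝ 1 F)
    (a b c d : ℝ)
    (hdiv : ∀ x ∈ Icc a b ×ˢ Icc c d,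
      0 < LinearMap.trace ℝ (ℝ × ℝ) (fderiv ℝ F x : (ℝ × ℝ) →ₗ[ℝ] ℝ × ℝ))
    (T : ℝ) (γ : ℝ → ℝ × ℝ) (hT : 0 < T) (hγ : ∀ t, HasDerivAt γ (F (γ t)) t)
    (hper : ∀ t, γ (t + T) = γ t) (hγQ : ∀ t, γ t ∈ Icc a b ×ˢ Icc c d)
    (h0 : F (γ 0) ≠ 0) : False := by
  have hc : Continuous γ := continuous_iff_continuousAt.2 fun t => (hγ t).continuousAt
  -- first return time
  have hne : ∀ᶠ t in nhdsWithin (0:ℝ) {0}ᶜ, γ t ≠ γ 0 := (hγ 0).eventually_ne h0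
  rw [eventually_nhdsWithin_iff, Metric.eventually_nhds_iff] at hne
  obtain ⟨δ, hδ, hne⟩ := hne
  have hTδ : δ ≤ T := by
    by_contra! hlt
    refine hne (y := T) ?_ hT.ne' ?_
    · rw [Real.dist_eq, sub_zero, abs_of_pos hT]; exact hlt
    · simpa using hper 0
  have hcomp : IsCompact (Icc δ T ∩ {t | γ t = γ 0}) :=
    isCompact_Icc.inter_right (isClosed_eq hc continuous_const)
  obtain ⟨L, ⟨hL, hLγ⟩, hLmin⟩ := hcomp.exists_isLeast ⟨T, ⟨hTδ, le_rfl⟩, by simpa using hper 0⟩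
  have hL0 : 0 < L := hδ.trans_le hL.1
  have hinj : ∀ t ∈ Ioo 0 L, γ t ≠ γ 0 := by
    intro t ht he
    by_cases htδ : t < δ
    · exact hne (by rw [Real.dist_eq, sub_zero, abs_of_pos ht.1]; exact htδ) ht.1.ne' he
    · exact absurd (hLmin ⟨⟨not_lt.1 htδ, ht.2.le.trans hL.2⟩, he⟩) (not_le.2 ht.2)
  set e := Complex.equivRealProdCLM.symm with he
  have hed : ∀ t, HasDerivAt (fun t => e (γ t)) (e (F (γ t))) t := fun t =>
    (e.toContinuousLinearMap.hasFDerivAt.comp_hasDerivAt t (hγ t))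
  obtain ⟨D, hDo, hDn, hDQ, hDS⟩ := exists_region (fun t => e (γ t)) (fun t => e (F (γ t))) hed
    (e.continuous.comp (hF.continuous.comp hc)) L hL0 (by simp only [mem_ofPred_eq] at hLγ; rw [hLγ])
    (by simp only [mem_ofPred_eq] at hLγ; rw [hLγ]) (by simpa using h0)
    (fun t ht h => hinj t ht (e.injective h)) a b c d
    (fun t => by simpa [he] using (hγQ t).1) (fun t => by simpa [he] using (hγQ t).2)
  refine euler F hF (Icc a b ×ˢ Icc c d) (isCompact_Icc.prod isCompact_Icc)
    ((convex_Icc a b).prod (convex_Icc c d)) hdiv T γ hT hγ hper hγQ (e ⁻¹' D)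
    (hDo.preimage e.continuous) (hDn.preimage e.surjective) ?_ ?_
  · intro x hx
    have := hDQ _ hx
    exact ⟨by simpa [he] using this.1, by simpa [he] using this.2⟩
  · intro x hx y hy
    by_contra! hcon
    apply hy
    refine hDS (e '' segment ℝ x y)
      ((convex_segment x y).isPreconnected.image _ e.continuous.continuousOn) ?_
      ⟨e x, ⟨x, left_mem_segment ℝ x y, rfl⟩, hx⟩ ⟨y, right_mem_segment ℝ x y, rfl⟩
    rintro _ ⟨z, hz, rfl⟩ ⟨t, -, ht⟩
    exact hcon z hz t (e.injective ht).symm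

/-- Bendixson's criterion. Let `F` be a C¹ planar vector field and
`Q = [a,b] × [c,d]` a closed rectangle on which the divergence of `F` (trace of the derivative)
is strictly positive. Then there is no nonconstant periodic solution of `x' = F(x)` whose image
is contained in `Q`. -/
theorem stmt_2
    (F : ℝ × ℝ → ℝ × ℝ) (hF : ContDiff ℝ 1 F)
    (a b c d : ℝ)
    (hdiv : ∀ x ∈ Icc a b ×ˢ Icc c d,
      0 < LinearMap.trace ℝ (ℝ × ℝ) (fderiv ℝ F x : (ℝ × ℝ) →ₗ[ℝ] ℝ × ℝ)) :
    ¬ ∃ (T : ℝ) (γ : ℝ → ℝ × ℝ), 0 < T ∧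
        (∀ t, HasDerivAt γ (F (γ t)) t) ∧
        (∀ t, γ (t + T) = γ t) ∧
        (∀ t, γ t ∈ Icc a b ×ˢ Icc c d) ∧
        ¬ (∃ p, ∀ t, γ t = p) := by
  rintro ⟨T, γ, hT, hγ, hper, hγQ, hnc⟩
  obtain ⟨t0, ht0⟩ : ∃ t0, F (γ t0) ≠ 0 := by
    by_contra! h
    refine hnc ⟨γ 0, fun t => ?_⟩
    exact is_const_of_deriv_eq_zero (fun s => (hγ s).differentiableAt)
      (fun s => by rw [(hγ s).deriv, h]) t 0
  refine bend_aux F hF a b c d hdiv T (fun t => γ (t + t0)) hT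
    (fun t => (hγ (t + t0)).comp_add_const t t0) (fun t => ?_) (fun t => hγQ _) (by simpa using ht0)
  rw [← hper (t + t0)]
  congr 1; ring
end

section
/- Let F : ℝ² → ℝ² be a continuously differentiable vector field admitting a global flow Φ, let p ∈ ℝ² satisfy F(p) = 0, and suppose the divergence of F at p is strictly positive. Then p is not asymptotically stable: there is no open neighborhood U of p such that for every x ∈ U the forward orbit t ↦ Φ(t,x) converges to p as t → ∞. -/
open Set Filter Topology MeasureTheory NormedSpace
open scoped NNReal ENNReal

/-- entries formula for the determinant -/
lemma det_entries (A : (ℝ × ℝ) →L[ℝ] ℝ × ℝ) :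
    A.det = (A (1,0)).1 * (A (0,1)).2 - (A (0,1)).1 * (A (1,0)).2 := by
  rw [ContinuousLinearMap.det, ← LinearMap.det_toMatrix (Module.Basis.finTwoProd ℝ), Matrix.det_fin_two]
  simp [LinearMap.toMatrix_apply]

lemma trace_entries (A : (ℝ × ℝ) →L[ℝ] ℝ × ℝ) :
    LinearMap.trace ℝ (ℝ × ℝ) (A : (ℝ × ℝ) →ₗ[ℝ] ℝ × ℝ) = (A (1,0)).1 + (A (0,1)).2 := by
  rw [LinearMap.trace_eq_matrix_trace ℝ (Module.Basis.finTwoProd ℝ), Matrix.trace_fin_two]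
  simp [LinearMap.toMatrix_apply]

lemma hasDeriv_exp (A : (ℝ × ℝ) →L[ℝ] ℝ × ℝ) (v : ℝ × ℝ) (t : ℝ) :
    HasDerivAt (fun u : ℝ => exp (u • A) v) (A (exp (t • A) v)) t := by
  have h := hasDerivAt_exp_smul_const' (𝕂 := ℝ) A t
  have h2 := (ContinuousLinearMap.apply ℝ (ℝ × ℝ) v).hasFDerivAt.comp_hasDerivAt t h
  exact h2

lemma exists_det_gt (A : (ℝ × ℝ) →L[ℝ] ℝ × ℝ)
    (h : 0 < LinearMap.trace ℝ (ℝ × ℝ) (A : (ℝ × ℝ) →ₗ[ℝ] ℝ × ℝ)) :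
    ∃ t : ℝ, 0 < t ∧ 1 < (exp (t • A)).det := by
  rw [trace_entries] at h
  have h1 : ∀ v, HasDerivAt (fun u : ℝ => (exp (u • A) v).1) (A v).1 0 := fun v => by
    have := (hasFDerivAt_fst (𝕜 := ℝ) (p := exp ((0:ℝ) • A) v)).comp_hasDerivAt 0 (hasDeriv_exp A v 0)
    have e : A v = A (exp ((0:ℝ) • A) v) := by simp
    rw [e]
    exact this
  have h2 : ∀ v, HasDerivAt (fun u : ℝ => (exp (u • A) v).2) (A v).2 0 := fun v => by
    have := (hasFDerivAt_snd (𝕜 := ℝ) (p := exp ((0:ℝ) • A) v)).comp_hasDerivAt 0 (hasDeriv_exp A v 0)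
    have e : A v = A (exp ((0:ℝ) • A) v) := by simp
    rw [e]
    exact this
  have hD := ((h1 (1,0)).mul (h2 (0,1))).sub ((h1 (0,1)).mul (h2 (1,0)))
  have hD' : HasDerivAt (fun t : ℝ => (exp (t • A)).det) ((A (1,0)).1 + (A (0,1)).2) 0 := by
    have e : (fun t : ℝ => (exp (t • A)).det) = _ := funext fun t => det_entries (exp (t • A))
    rw [e]
    refine hD.congr_deriv ?_
    simp
  have ev := (hasDerivAt_iff_tendsto_slope.1 hD').eventually_const_lt h
  have ev2 : ∀ᶠ t in 𝓝[>] (0:ℝ), 0 < slope (fun t : ℝ => (exp (t • A)).det) 0 t :=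
    ev.filter_mono (nhdsWithin_mono _ fun x hx => ne_of_gt hx)
  obtain ⟨t, ht, ht0⟩ := (ev2.and self_mem_nhdsWithin).exists
  refine ⟨t, ht0, ?_⟩
  have ht0' : (0:ℝ) < t := ht0
  rw [slope_def_field] at ht
  have := (div_pos_iff_of_pos_right (by simpa using ht0')).1 ht
  simp [ContinuousLinearMap.det] at this
  simpa [ContinuousLinearMap.det] using this

/-- Gronwall, homogeneous. -/
lemma gron (w w' : ℝ → ℝ × ℝ) (K T : ℝ) 
    (hw : ∀ t, HasDerivAt w (w' t) t) (hb : ∀ t, 0 ≤ t → t ≤ T → ‖w' t‖ ≤ K * ‖w t‖) :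
    ∀ t, 0 ≤ t → t ≤ T → ‖w t‖ ≤ ‖w 0‖ * Real.exp (K * t) := by
  intro t h0 h1
  have := norm_le_gronwallBound_of_norm_deriv_right_le (f := w) (f' := w') (δ := ‖w 0‖) (K := K)
    (ε := 0) (a := 0) (b := T) (fun x _ => (hw x).continuousAt.continuousWithinAt)
    (fun x _ => (hw x).hasDerivWithinAt) le_rfl (fun x hx => by simpa using hb x hx.1 hx.2.le)
    t ⟨h0, h1⟩
  simpa [gronwallBound_ε0] using this

lemma gron2 (w w' : ℝ → ℝ × ℝ) (K T ε : ℝ) (hK : 1 ≤ K) (hε : 0 ≤ ε) (hT : 0 ≤ T)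
    (hw : ∀ t, HasDerivAt w (w' t) t) (h0 : w 0 = 0)
    (hb : ∀ t, 0 ≤ t → t ≤ T → ‖w' t‖ ≤ K * ‖w t‖ + ε) :
    ‖w T‖ ≤ ε * Real.exp (K * T) := by
  have := norm_le_gronwallBound_of_norm_deriv_right_le (f := w) (f' := w') (δ := 0) (K := K)
    (ε := ε) (a := 0) (b := T) (fun x _ => (hw x).continuousAt.continuousWithinAt)
    (fun x _ => (hw x).hasDerivWithinAt) (by simp [h0]) (fun x hx => hb x hx.1 hx.2.le)
    T ⟨hT, le_rfl⟩
  rw [gronwallBound_of_K_ne_0 (by positivity)] at this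
  simp only [zero_mul, zero_add, sub_zero] at this
  refine this.trans ?_
  have h1 : ε / K ≤ ε := div_le_self hε hK
  have h2 : 0 ≤ Real.exp (K * T) - 1 := by
    have := Real.one_le_exp (x := K * T) (by positivity)
    linarith
  calc _ ≤ ε * (Real.exp (K * T) - 1) := by gcongr
    _ ≤ _ := by gcongr; linarith

/-- The set of points staying in a small neighborhood is null. -/
lemma exists_null
    (F : ℝ × ℝ → ℝ × ℝ) (hF : ContDiff ℝ 1 F)
    (Φ : ℝ → ℝ × ℝ → ℝ × ℝ)
    (hΦ0 : ∀ x, Φ 0 x = x)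
    (hΦadd : ∀ t s x, Φ (t + s) x = Φ t (Φ s x))
    (hΦderiv : ∀ x t, HasDerivAt (fun τ => Φ τ x) (F (Φ t x)) t)
    (p : ℝ × ℝ)
    (hdiv : 0 < LinearMap.trace ℝ (ℝ × ℝ) (fderiv ℝ F p : (ℝ × ℝ) →ₗ[ℝ] ℝ × ℝ)) :
    ∃ V ∈ 𝓝 p, volume {x | ∀ t, 0 ≤ t → Φ t x ∈ V} = 0 := by
  set A := fderiv ℝ F p with hA
  obtain ⟨T, hT, hdet⟩ := exists_det_gt A hdiv
  obtain ⟨m, hm1, hm2⟩ := exists_between hdet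
  have hm0 : (0:ℝ) ≤ m := by linarith
  lift m to ℝ≥0 using hm0
  have hlt : (m : ℝ≥0∞) < ENNReal.ofReal |(exp (T • A)).det| := by
    rw [← ENNReal.ofReal_coe_nnreal]
    refine (ENNReal.ofReal_lt_ofReal_iff ?_).2 ?_
    · exact abs_pos.2 (by linarith)
    · exact lt_of_lt_of_le hm2 (le_abs_self _)
  obtain ⟨δ, hδ, hδ0⟩ :=
    ((mul_le_addHaar_image_of_lt_det (volume : Measure (ℝ × ℝ)) _ hlt).and self_mem_nhdsWithin).exists
  have hδ0' : (0:ℝ) < δ := hδ0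
  set K : ℝ := ‖A‖ + 1 with hK
  have hK1 : 1 ≤ K := by have := norm_nonneg A; linarith
  have hexp := Real.exp_pos (K * T)
  set ε : ℝ := min 1 (δ / (Real.exp (K * T) * Real.exp (K * T))) with hεd
  have hε : 0 < ε := lt_min one_pos (by positivity)
  have hε1 : ε ≤ 1 := min_le_left _ _
  have hε2 : ε * (Real.exp (K * T) * Real.exp (K * T)) ≤ δ := by
    rw [← le_div_iff₀ (by positivity)]; exact min_le_right _ _
  have hstrict : HasStrictFDerivAt F A p := hF.contDiffAt.hasStrictFDerivAt (by simp)
  obtain ⟨s, hs, hsA⟩ := hstrict.approximates_deriv_on_nhds (c := ⟨ε, hε.le⟩) (Or.inr hε)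
  have hsA' : ∀ x ∈ s, ∀ y ∈ s, ‖F x - F y - A (x - y)‖ ≤ ε * ‖x - y‖ := fun x hx y hy => hsA x hx y hy
  refine ⟨s ∩ Metric.ball p 1, inter_mem hs (Metric.ball_mem_nhds _ one_pos), ?_⟩
  set C := {x | ∀ t, 0 ≤ t → Φ t x ∈ s ∩ Metric.ball p 1} with hC
  have happ : ApproximatesLinearOn (Φ T) (exp (T • A)) C δ := by
    intro x hx y hy
    have hw : ∀ t, HasDerivAt (fun t => Φ t x - Φ t y) (F (Φ t x) - F (Φ t y)) t :=
      fun t => (hΦderiv x t).sub (hΦderiv y t)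
    have hwb : ∀ t, 0 ≤ t → t ≤ T → ‖Φ t x - Φ t y‖ ≤ ‖x - y‖ * Real.exp (K * T) := by
      intro t h0 h1
      have := gron _ _ K T hw (fun t h0 h1 => by
        have h3 := hsA' _ (hx t h0).1 _ (hy t h0).1
        have h4 := A.le_opNorm (Φ t x - Φ t y)
        have h5 := norm_le_norm_sub_add (F (Φ t x) - F (Φ t y)) (A (Φ t x - Φ t y))
        have h6 := mul_le_mul_of_nonneg_right hε1 (norm_nonneg (Φ t x - Φ t y))
        rw [hK, add_mul]
        linarith) t h0 h1
      simp only [hΦ0] at this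
      refine this.trans ?_
      gcongr
    have hv : ∀ t, HasDerivAt (fun t => Φ t x - Φ t y - exp (t • A) (x - y))
        (F (Φ t x) - F (Φ t y) - A (exp (t • A) (x - y))) t :=
      fun t => (hw t).sub (hasDeriv_exp A _ t)
    have := gron2 _ _ K T (ε * (‖x - y‖ * Real.exp (K * T))) hK1 (by positivity) hT.le hv
      (by simp [hΦ0]) (fun t h0 h1 => by
        have h3 := hsA' _ (hx t h0).1 _ (hy t h0).1
        have h4 := A.le_opNorm (Φ t x - Φ t y - exp (t • A) (x - y))
        have h5 := norm_add_le (F (Φ t x) - F (Φ t y) - A (Φ t x - Φ t y))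
          (A (Φ t x - Φ t y - exp (t • A) (x - y)))
        have h6 := mul_le_mul_of_nonneg_left (hwb t h0 h1) hε.le
        have h7 := norm_nonneg (Φ t x - Φ t y - exp (t • A) (x - y))
        have e : F (Φ t x) - F (Φ t y) - A (exp (t • A) (x - y)) =
          (F (Φ t x) - F (Φ t y) - A (Φ t x - Φ t y)) +
          (A (Φ t x - Φ t y - exp (t • A) (x - y))) := by
          rw [map_sub A (Φ t x - Φ t y)]; abel
        rw [e, hK, add_mul]
        linarith)
    refine this.trans ?_
    calc _ = ε * (Real.exp (K * T) * Real.exp (K * T)) * ‖x - y‖ := by ring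
      _ ≤ _ := by gcongr
  have h1 := hδ C _ happ
  have h2 : Φ T '' C ⊆ C := by
    rintro _ ⟨x, hx, rfl⟩ t ht
    rw [← hΦadd]
    exact hx _ (by linarith)
  have h3 := h1.trans (measure_mono h2)
  have hfin : volume C ≠ ∞ := by
    refine ne_top_of_le_ne_top (Metric.isBounded_ball (x := p) (r := 1)).measure_lt_top.ne
      (measure_mono fun x hx => ?_)
    have := (hx 0 le_rfl).2
    rwa [hΦ0] at this
  by_contra hne
  have h4 : (1:ℝ≥0∞) * volume C < (m : ℝ≥0∞) * volume C := by
    refine ENNReal.mul_lt_mul_left hne hfin ?_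
    exact_mod_cast hm1
  rw [one_mul] at h4
  exact absurd h3 (not_le.2 h4)

/-- Let `F` be a C¹ planar vector field with global flow `Φ`, let `p` be a zero
of `F`, and suppose the divergence of `F` at `p` (the trace of the derivative of `F` at `p`) is
strictly positive. Then `p` is not asymptotically stable: there is no open neighborhood `U` of
`p` all of whose points have forward orbits converging to `p`. -/
theorem stmt_3
    (F : ℝ × ℝ → ℝ × ℝ) (hF : ContDiff ℝ 1 F)
    (Φ : ℝ → ℝ × ℝ → ℝ × ℝ)
    (hΦ0 : ∀ x, Φ 0 x = x)
    (hΦadd : ∀ t s x, Φ (t + s) x = Φ t (Φ s x))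
    (hΦderiv : ∀ x t, HasDerivAt (fun τ => Φ τ x) (F (Φ t x)) t)
    (p : ℝ × ℝ) (hp : F p = 0)
    (hdiv : 0 < LinearMap.trace ℝ (ℝ × ℝ) (fderiv ℝ F p : (ℝ × ℝ) →ₗ[ℝ] ℝ × ℝ)) :
    ¬ ∃ U : Set (ℝ × ℝ), IsOpen U ∧ p ∈ U ∧
        ∀ x ∈ U, Filter.Tendsto (fun t => Φ t x) Filter.atTop (nhds p) := by
  rintro ⟨U, hU, hpU, hconv⟩
  obtain ⟨V, hV, hnull⟩ := exists_null F hF Φ hΦ0 hΦadd hΦderiv p hdiv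
  set C := {x | ∀ t, 0 ≤ t → Φ t x ∈ V} with hC
  let S : ℕ × ℕ → Set (ℝ × ℝ) := fun q =>
    {x | Φ q.1 x ∈ C ∧ ∀ t : ℝ, 0 ≤ t → t ≤ q.1 → Φ t x ∈ Metric.closedBall 0 (q.2 : ℝ)}
  have hS : ∀ q, volume (S q) = 0 := by
    rintro ⟨n, R⟩
    obtain ⟨L, hL⟩ := (hF.contDiffOn (s := Metric.closedBall (0 : ℝ × ℝ) (R : ℝ))).exists_lipschitzOnWith
      one_ne_zero (convex_closedBall _ _) (isCompact_closedBall _ _)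
    have hlip : LipschitzOnWith (Real.toNNReal (Real.exp (L * n))) (Φ (-(n:ℝ)))
        (Φ n '' S (n, R)) := by
      refine LipschitzOnWith.of_dist_le_mul ?_
      rintro _ ⟨x, hx, rfl⟩ _ ⟨y, hy, rfl⟩
      have key : ∀ t : ℝ, ∀ x, HasDerivAt (fun τ => Φ ((n:ℝ) - τ) x) (- F (Φ ((n:ℝ) - t) x)) t := by
        intro t x
        have := (hΦderiv x ((n:ℝ) - t)).scomp t ((hasDerivAt_id t).const_sub (n:ℝ))
        simpa [Function.comp_def] using this
      have := gron _ _ L n (fun t => (key t x).sub (key t y)) (fun t h0 h1 => by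
        have := hL.dist_le_mul _ (hx.2 ((n:ℝ) - t) (by linarith) (by simpa using h0)) _
          (hy.2 ((n:ℝ) - t) (by linarith) (by simpa using h0))
        rw [dist_eq_norm, dist_eq_norm] at this
        have e : -F (Φ ((n:ℝ) - t) x) - -F (Φ ((n:ℝ) - t) y) =
            -(F (Φ ((n:ℝ) - t) x) - F (Φ ((n:ℝ) - t) y)) := by abel
        rw [e, norm_neg]
        exact this) n (Nat.cast_nonneg n) le_rfl
      rw [dist_eq_norm, dist_eq_norm, ← hΦadd, ← hΦadd]
      rw [Real.coe_toNNReal _ (Real.exp_pos _).le]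
      simp only [Pi.sub_apply, sub_self, sub_zero, neg_add_cancel] at this ⊢
      rw [mul_comm]
      exact this
    have himg : volume (Φ n '' S (n, R)) = 0 :=
      measure_mono_null (by rintro _ ⟨x, hx, rfl⟩; exact hx.1) hnull
    have h2 := hlip.hausdorffMeasure_image_le (d := 2) (by norm_num)
    rw [hausdorffMeasure_prod_real, himg, mul_zero, ← image_comp] at h2
    have e : Φ (-(n:ℝ)) ∘ Φ n = id := by
      funext x; simp [← hΦadd, hΦ0]
    rw [e, image_id] at h2
    exact le_antisymm h2 zero_le
  have hcov : U ⊆ ⋃ q, S q := by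
    intro x hx
    obtain ⟨t₀, ht₀⟩ := (eventually_atTop.1 ((hconv x hx).eventually_mem hV))
    obtain ⟨n, hn⟩ := exists_nat_ge t₀
    have hc : ContinuousOn (fun t => Φ t x) (Icc 0 (n:ℝ)) :=
      fun t _ => (hΦderiv x t).continuousAt.continuousWithinAt
    obtain ⟨R, hR⟩ := (isCompact_Icc.image_of_continuousOn hc).isBounded.subset_closedBall 0
    obtain ⟨R', hR'⟩ := exists_nat_ge R
    refine mem_iUnion.2 ⟨(n, R'), ?_, ?_⟩
    · intro t ht
      rw [← hΦadd]
      exact ht₀ _ (by simp only; linarith)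
    · intro t h0 h1
      exact Metric.closedBall_subset_closedBall hR' (hR ⟨t, ⟨h0, h1⟩, rfl⟩)
  have h0 : volume U = 0 := measure_mono_null hcov (measure_iUnion_null hS)
  exact (hU.measure_pos volume ⟨p, hpU⟩).ne' h0
end

section
/- Consider the planar vector field F_ε(R,φ) = (f(R,φ) + ε_m·g(R), ε_e·h(R,φ)) on [0,1]×[0,1], where f, h : ℝ² → ℝ and g : ℝ → ℝ are continuous, with: (EXT) f(0,φ) = f(1,φ) = 0 for all φ; (MUT) g(0) > 0 and g(1) < 0; (NF2a) there exist 0 < φ₋₋ < φ₊₊ < 1 such that f(R,φ) > 0 for all R ∈ (0,1) when φ < φ₋₋, and f(R,φ) < 0 for all R ∈ (0,1) when φ > φ₊₊; (NF2b) there exist 0 < a < b < 1 and 0 < c < φ₋₋, φ₊₊ < d < 1 such that h(R,φ) < 0 whenever R ∈ [0,a] and φ ∈ [c,1], and h(R,φ) > 0 whenever R ∈ [b,1] and φ ∈ [0,d]. Then there exists ε₀ > 0 such that for every ε_m ∈ (0,ε₀) and every ε_e > 0, every point (R,φ) ∈ [0,1]×[0,1] with f(R,φ) + ε_m·g(R)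 = 0 and ε_e·h(R,φ) = 0 lies in the rectangle [a,b]×[c,d]. -/
open Set

lemma aux_pos (K : Set (ℝ × ℝ)) (hK : IsCompact K) (F G : ℝ × ℝ → ℝ)
    (hF : Continuous F) (hG : Continuous G)
    (hp : ∀ p ∈ K, 0 ≤ F p) (hz : ∀ p ∈ K, G p ≤ 0 → 0 < F p) :
    ∃ e > 0, ∀ ε ∈ Ioo (0 : ℝ) e, ∀ p ∈ K, 0 < F p + ε * G p := by
  have hK' : IsCompact (K ∩ {p | G p ≤ 0}) :=
    hK.inter_right (isClosed_le hG continuous_const)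
  obtain ⟨m, hm, hmF⟩ : ∃ m > 0, ∀ p ∈ K ∩ {p | G p ≤ 0}, m ≤ F p := by
    rcases (K ∩ {p | G p ≤ 0}).eq_empty_or_nonempty with he | hne
    · exact ⟨1, one_pos, by simp [he]⟩
    · obtain ⟨x, hx, hmin⟩ := hK'.exists_isMinOn hne hF.continuousOn
      exact ⟨F x, hz x hx.1 hx.2, fun p hpp => hmin hpp⟩
  obtain ⟨M, hM⟩ := hK.exists_bound_of_continuousOn hG.continuousOn
  have hM1 : 0 < |M| + 1 := by positivity
  refine ⟨m / (|M| + 1), div_pos hm hM1, fun ε hε p hpK => ?_⟩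
  have h2 : ε * (|M| + 1) < m := (lt_div_iff₀ hM1).1 hε.2
  by_cases hg : G p ≤ 0
  · have h1 := hmF p ⟨hpK, hg⟩
    have h3 := hM p hpK
    rw [Real.norm_eq_abs] at h3
    have h4 := neg_abs_le (G p)
    have h5 := le_abs_self M
    have h6 : ε * (-(|M| + 1)) ≤ ε * G p :=
      mul_le_mul_of_nonneg_left (by linarith) hε.1.le
    linarith
  · push Not at hg
    have := hp p hpK
    have := mul_pos hε.1 hg
    linarith

/-- For the planar vector field
`F_ε(R,φ) = (f(R,φ) + ε_m·g(R), ε_e·h(R,φ))` on the unit square, with `f, g, h` continuous and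
satisfying (EXT), (MUT), (NF2a), (NF2b), there exists `ε₀ > 0` such that for every
`ε_m ∈ (0, ε₀)` and every `ε_e > 0`, every fixed point of `F_ε` in the unit square lies in the
rectangle `[a,b] × [c,d]`. -/
theorem stmt_5
    (f h : ℝ × ℝ → ℝ) (g : ℝ → ℝ)
    (hf : Continuous f) (hh : Continuous h) (hg : Continuous g)
    -- (EXT)
    (hEXT : ∀ φ : ℝ, f (0, φ) = 0 ∧ f (1, φ) = 0)
    -- (MUT)
    (hMUT0 : 0 < g 0) (hMUT1 : g 1 < 0)
    -- (NF2a)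
    (φmm φpp : ℝ) (hφ0 : 0 < φmm) (hφ1 : φmm < φpp) (hφ2 : φpp < 1)
    (hNF2a1 : ∀ R ∈ Ioo (0 : ℝ) 1, ∀ φ : ℝ, φ < φmm → 0 < f (R, φ))
    (hNF2a2 : ∀ R ∈ Ioo (0 : ℝ) 1, ∀ φ : ℝ, φpp < φ → f (R, φ) < 0)
    -- (NF2b)
    (a b c d : ℝ) (ha : 0 < a) (hab : a < b) (hb1 : b < 1)
    (hc : 0 < c) (hcφ : c < φmm) (hφd : φpp < d) (hd1 : d < 1)
    (hhneg : ∀ R ∈ Icc (0 : ℝ) a, ∀ φ ∈ Icc c (1 : ℝ), h (R, φ) < 0)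
    (hhpos : ∀ R ∈ Icc b (1 : ℝ), ∀ φ ∈ Icc (0 : ℝ) d, 0 < h (R, φ)) :
    ∃ ε₀ > 0, ∀ εm ∈ Ioo (0 : ℝ) ε₀, ∀ εe : ℝ, 0 < εe →
      ∀ R φ : ℝ, (R, φ) ∈ Icc (0 : ℝ) 1 ×ˢ Icc (0 : ℝ) 1 →
        f (R, φ) + εm * g R = 0 → εe * h (R, φ) = 0 →
        (R, φ) ∈ Icc a b ×ˢ Icc c d := by
  obtain ⟨e1, he1, H1⟩ := aux_pos (Icc 0 b ×ˢ Icc 0 c) (isCompact_Icc.prod isCompact_Icc)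
    f (fun p => g p.1) hf (by fun_prop)
    (by
      rintro ⟨R, φ⟩ ⟨⟨h1, h2⟩, h3, h4⟩
      simp only at h1 h2 h3 h4
      rcases h1.eq_or_lt with rfl | h1
      · exact (hEXT φ).1.ge
      · exact (hNF2a1 R ⟨h1, by linarith⟩ φ (by linarith)).le)
    (by
      rintro ⟨R, φ⟩ ⟨⟨h1, h2⟩, h3, h4⟩ h5
      simp only at h1 h2 h3 h4 h5
      rcases h1.eq_or_lt with rfl | h1
      · linarith
      · exact hNF2a1 R ⟨h1, by linarith⟩ φ (by linarith))
  obtain ⟨e2, he2, H2⟩ := aux_pos (Icc a 1 ×ˢ Icc d 1) (isCompact_Icc.prod isCompact_Icc)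
    (fun p => -f p) (fun p => -g p.1) (by fun_prop) (by fun_prop)
    (by
      rintro ⟨R, φ⟩ ⟨⟨h1, h2⟩, h3, h4⟩
      simp only at h1 h2 h3 h4
      rcases h2.eq_or_lt with rfl | h2
      · simp [(hEXT φ).2]
      · have := hNF2a2 R ⟨by linarith, h2⟩ φ (by linarith)
        linarith)
    (by
      rintro ⟨R, φ⟩ ⟨⟨h1, h2⟩, h3, h4⟩ h5
      simp only at h1 h2 h3 h4 h5
      rcases h2.eq_or_lt with rfl | h2
      · linarith
      · have := hNF2a2 R ⟨by linarith, h2⟩ φ (by linarith)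
        linarith)
  refine ⟨min e1 e2, lt_min he1 he2, ?_⟩
  rintro εm ⟨hm0, hm1⟩ εe hεe R φ ⟨⟨hR0, hR1⟩, hp0, hp1⟩ hfz hhz
  simp only at hR0 hR1 hp0 hp1
  have hz : h (R, φ) = 0 := (mul_eq_zero.1 hhz).resolve_left hεe.ne'
  have A : c ≤ φ → a ≤ R := fun hcp => by
    by_contra! hlt
    have := hhneg R ⟨hR0, hlt.le⟩ φ ⟨hcp, hp1⟩
    linarith
  have B : φ ≤ d → R ≤ b := fun hpd => by
    by_contra! hlt
    have := hhpos R ⟨hlt.le, hR1⟩ φ ⟨hp0, hpd⟩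
    linarith
  have C : c ≤ φ := by
    by_contra! hlt
    have := H1 εm ⟨hm0, hm1.trans_le (min_le_left _ _)⟩ (R, φ)
      ⟨⟨hR0, B (by linarith)⟩, hp0, hlt.le⟩
    simp only at this
    linarith
  have D : φ ≤ d := by
    by_contra! hlt
    have := H2 εm ⟨hm0, hm1.trans_le (min_le_right _ _)⟩ (R, φ)
      ⟨⟨A C, hR1⟩, hlt.le, hp1⟩
    simp only at this
    linarith
  exact ⟨⟨A C, B D⟩, C, D⟩
end

section
/- Let f_A, f_B : ℝ³ → ℝ be differentiable and fix φ ∈ ℝ. Suppose (A₀,B₀) with A₀ > 0, B₀ > 0 satisfies f_A(A₀,B₀,φ) = 0 and f_B(A₀,B₀,φ) = 0, and that at the point (A₀,B₀,φ): ∂f_A/∂A ≤ 0, ∂f_B/∂B ≤ 0, (∂/∂A − ∂/∂B) f_A > 0, and (∂/∂B − ∂/∂A) f_B > 0. Then the Jacobian matrix at (A₀,B₀) of the map (A,B) ↦ (A·f_A(A,B,φ), B·f_B(A,B,φ)) has strictly negative determinant; in particular its eigenvalues are real, nonzero, and of opposite signs, so (A₀,B₀) is a hyperbolic saddle fixed point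 of the ecological dynamics dA/dt = A·f_A, dB/dt = B·f_B. -/
theorem aux_det_s9 (L : (ℝ × ℝ) →ₗ[ℝ] ℝ × ℝ) (p q r s : ℝ) (h1 : L (1, 0) = (p, r))
    (h2 : L (0, 1) = (q, s)) : LinearMap.det L = p * s - q * r := by
  rw [← LinearMap.det_toMatrix (Module.Basis.finTwoProd ℝ), Matrix.det_fin_two]
  simp [LinearMap.toMatrix_apply, h1, h2]

theorem aux_eig (L : (ℝ × ℝ) →ₗ[ℝ] ℝ × ℝ) (p q r s l : ℝ) (h1 : L (1, 0) = (p, r))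
    (h2 : L (0, 1) = (q, s)) (hq : q ≠ 0) (hl : l ^ 2 - (p + s) * l + (p * s - q * r) = 0) :
    Module.End.HasEigenvalue L l := by
  apply Module.End.hasEigenvalue_of_hasEigenvector (x := (q, l - p))
  refine ⟨?_, ?_⟩
  · rw [Module.End.mem_eigenspace_iff]
    have : ((q, l - p) : ℝ × ℝ) = q • ((1, 0) : ℝ × ℝ) + (l - p) • ((0, 1) : ℝ × ℝ) := by
      simp
    rw [this, map_add, map_smul, map_smul, h1, h2]
    ext
    · simp; ring
    · simp; linarith
  · intro h
    exact hq (congrArg Prod.fst h)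

theorem aux_roots (t d : ℝ) (hd : d < 0) : ∃ l₁ l₂ : ℝ, l₁ < 0 ∧ 0 < l₂ ∧
    l₁ ^ 2 - t * l₁ + d = 0 ∧ l₂ ^ 2 - t * l₂ + d = 0 := by
  have h0 : 0 ≤ t ^ 2 - 4 * d := by nlinarith [sq_nonneg t]
  have hs := Real.sq_sqrt h0
  have habs : |t| < Real.sqrt (t ^ 2 - 4 * d) := by
    rw [← Real.sqrt_sq_eq_abs]
    exact Real.sqrt_lt_sqrt (sq_nonneg t) (by linarith)
  obtain ⟨ha, hb⟩ := abs_lt.mp habs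
  set w := Real.sqrt (t ^ 2 - 4 * d)
  exact ⟨(t - w) / 2, (t + w) / 2, by linarith, by linarith, by nlinarith, by nlinarith⟩

theorem aux_partial (f : ℝ × ℝ × ℝ → ℝ) (hf : Differentiable ℝ f) (φ a b : ℝ) :
    ∃ G : ℝ × ℝ →L[ℝ] ℝ, HasFDerivAt (fun p : ℝ × ℝ => f (p.1, p.2, φ)) G (a, b) ∧
      G (1, 0) = deriv (fun x => f (x, b, φ)) a ∧ G (0, 1) = deriv (fun y => f (a, y, φ)) b := by
  have hd : DifferentiableAt ℝ (fun p : ℝ × ℝ => f (p.1, p.2, φ)) (a, b) := by fun_prop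
  refine ⟨_, hd.hasFDerivAt, ?_, ?_⟩
  · have h := (hasDerivAt_id a).prodMk (hasDerivAt_const a b)
    exact (HasFDerivAt.comp_hasDerivAt (f := fun x : ℝ => (x, b)) a hd.hasFDerivAt h).deriv.symm
  · have h := (hasDerivAt_const b a).prodMk (hasDerivAt_id b)
    exact (HasFDerivAt.comp_hasDerivAt (f := fun x : ℝ => (a, x)) b hd.hasFDerivAt h).deriv.symm


/-- Let `f_A, f_B : ℝ³ → ℝ` be differentiable and fix `φ`. If `(A₀, B₀)` with
`A₀, B₀ > 0` is a joint zero of `f_A, f_B` and at this point `∂f_A/∂A ≤ 0`, `∂f_B/∂B ≤ 0`,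
`(∂/∂A − ∂/∂B) f_A > 0` and `(∂/∂B − ∂/∂A) f_B > 0`, then the Jacobian of
`(A,B) ↦ (A·f_A, B·f_B)` at `(A₀,B₀)` has strictly negative determinant; in particular it has
two real eigenvalues of opposite signs, so `(A₀,B₀)` is a hyperbolic saddle. -/
theorem stmt_9
    (fA fB : ℝ × ℝ × ℝ → ℝ)
    (hfA : Differentiable ℝ fA) (hfB : Differentiable ℝ fB)
    (φ A₀ B₀ : ℝ) (hA₀ : 0 < A₀) (hB₀ : 0 < B₀)
    (hzeroA : fA (A₀, B₀, φ) = 0) (hzeroB : fB (A₀, B₀, φ) = 0)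
    (hAA : deriv (fun A => fA (A, B₀, φ)) A₀ ≤ 0)
    (hBB : deriv (fun B => fB (A₀, B, φ)) B₀ ≤ 0)
    (hPFA : 0 < deriv (fun A => fA (A, B₀, φ)) A₀ - deriv (fun B => fA (A₀, B, φ)) B₀)
    (hPFB : 0 < deriv (fun B => fB (A₀, B, φ)) B₀ - deriv (fun A => fB (A, B₀, φ)) A₀) :
    LinearMap.det
        ((fderiv ℝ (fun p : ℝ × ℝ => (p.1 * fA (p.1, p.2, φ), p.2 * fB (p.1, p.2, φ)))
          (A₀, B₀) : (ℝ × ℝ) →ₗ[ℝ] ℝ × ℝ)) < 0 ∧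
      ∃ lam₁ lam₂ : ℝ, lam₁ < 0 ∧ 0 < lam₂ ∧
        Module.End.HasEigenvalue
          ((fderiv ℝ (fun p : ℝ × ℝ => (p.1 * fA (p.1, p.2, φ), p.2 * fB (p.1, p.2, φ)))
            (A₀, B₀) : (ℝ × ℝ) →ₗ[ℝ] ℝ × ℝ)) lam₁ ∧
        Module.End.HasEigenvalue
          ((fderiv ℝ (fun p : ℝ × ℝ => (p.1 * fA (p.1, p.2, φ), p.2 * fB (p.1, p.2, φ)))
            (A₀, B₀) : (ℝ × ℝ) →ₗ[ℝ] ℝ × ℝ)) lam₂ := by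
  obtain ⟨GA, hGA, hA1, hA2⟩ := aux_partial fA hfA φ A₀ B₀
  obtain ⟨GB, hGB, hB1, hB2⟩ := aux_partial fB hfB φ A₀ B₀
  rw [← hA1] at hAA hPFA
  rw [← hA2] at hPFA
  rw [← hB2] at hBB hPFB
  rw [← hB1] at hPFB
  have hF := ((hasFDerivAt_fst (𝕜 := ℝ) (p := ((A₀, B₀) : ℝ × ℝ))).mul hGA).prodMk
    ((hasFDerivAt_snd (𝕜 := ℝ) (p := ((A₀, B₀) : ℝ × ℝ))).mul hGB)
  have hF' := hF.fderiv
  simp only [Pi.mul_def] at hF'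
  rw [hF']
  generalize hL : ((_ : (ℝ × ℝ) →L[ℝ] ℝ × ℝ) : (ℝ × ℝ) →ₗ[ℝ] ℝ × ℝ) = L
  have h1 : L (1, 0) = (A₀ * GA (1, 0), B₀ * GB (1, 0)) := by
    rw [← hL]; simp [hzeroA, hzeroB]
  have h2 : L (0, 1) = (A₀ * GA (0, 1), B₀ * GB (0, 1)) := by
    rw [← hL]; simp [hzeroA, hzeroB]
  have hdet : A₀ * GA (1, 0) * (B₀ * GB (0, 1)) - A₀ * GA (0, 1) * (B₀ * GB (1, 0)) < 0 := by
    have hk : GA (1, 0) * GB (0, 1) - GA (0, 1) * GB (1, 0) < 0 := by nlinarith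
    have := mul_neg_of_pos_of_neg (mul_pos hA₀ hB₀) hk
    linarith
  have hq : A₀ * GA (0, 1) ≠ 0 := mul_ne_zero hA₀.ne' (by linarith : GA (0, 1) < 0).ne
  refine ⟨by rw [aux_det_s9 L _ _ _ _ h1 h2]; exact hdet, ?_⟩
  obtain ⟨l₁, l₂, hl1, hl2, e1, e2⟩ := aux_roots (A₀ * GA (1, 0) + B₀ * GB (0, 1)) _ hdet
  exact ⟨l₁, l₂, hl1, hl2, aux_eig L _ _ _ _ _ h1 h2 hq e1, aux_eig L _ _ _ _ _ h1 h2 hq e2⟩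
end
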